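/- Let k > 1 and let X ⊆ ℂ^{3k-1} be a compact polynomially convex set that is a 2k-dimensional smooth submanifold totally real except at a finite set S ⊆ X of generic CR-singularities. Then every continuous complex-valued function on X can be approximated uniformly on X by holomorphic polynomials (i.e., 𝒫(X) = C(X)); consequently, every compact subset T ⊆ X is polynomially convex. -/

import Mathlib

open scoped Manifold ComplexConjugate

noncomputable section

/-- Evaluation of a holomorphic polynomial on `ℂ^n`. -/
def evalPoly {n : ℕ} (P : MvPolynomial (Fin n) ℂ) (z : EuclideanSpace ℂ (Fin n)) : ℂ :=
  MvPolynomial.eval (fun i => z i) P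

/-- The polynomially convex hull of a set `K ⊆ ℂ^n`. -/
def polyHull {n : ℕ} (K : Set (EuclideanSpace ℂ (Fin n))) : Set (EuclideanSpace ℂ (Fin n)) :=
  {z | ∀ P : MvPolynomial (Fin n) ℂ, ‖evalPoly P z‖ ≤ ⨆ w ∈ K, ‖evalPoly P w‖}

/-- A set is polynomially convex if it coincides with its polynomially convex hull. -/
def IsPolyConvex {n : ℕ} (K : Set (EuclideanSpace ℂ (Fin n))) : Prop := polyHull K = K

/-- The rationally convex hull of a set `K ⊆ ℂ^n`. -/
def ratHull {n : ℕ} (K : Set (EuclideanSpace ℂ (Fin n))) : Set (EuclideanSpace ℂ (Fin n)) :=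
  {z | ∀ P : MvPolynomial (Fin n) ℂ, evalPoly P z = 0 → ∃ w ∈ K, evalPoly P w = 0}

/-- The closed half-space `{x ∈ ℝ^d : x₀ ≥ 0}`. -/
def halfSpace (d : ℕ) (hd : 0 < d) : Set (EuclideanSpace ℝ (Fin d)) :=
  {x | 0 ≤ x ⟨0, hd⟩}

/-- `M ⊆ ℂ^n` is a `d`-dimensional smooth compact submanifold (possibly with boundary):
every point admits a smooth local parametrization by a relatively open subset of the closed
half-space `H ⊆ ℝ^d`, which is an immersion and a homeomorphism onto a relatively open
subset of `M`. (Charts with image in the open half-space cover interior points, so closed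
submanifolds are included.) -/
def IsSubmanifold {n : ℕ} (d : ℕ) (hd : 0 < d) (M : Set (EuclideanSpace ℂ (Fin n))) : Prop :=
  ∀ p ∈ M, ∃ (V : Set (EuclideanSpace ℝ (Fin d))) (U : Set (EuclideanSpace ℂ (Fin n)))
    (f : EuclideanSpace ℝ (Fin d) → EuclideanSpace ℂ (Fin n)),
    IsOpen V ∧ IsOpen U ∧ p ∈ U ∧ ContDiffOn ℝ (⊤ : ℕ∞) f V ∧
    Set.InjOn f (V ∩ halfSpace d hd) ∧
    (∀ x ∈ V, Function.Injective (fderiv ℝ f x)) ∧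
    f '' (V ∩ halfSpace d hd) = M ∩ U ∧
    (∀ W, IsOpen W → W ⊆ V → ∃ U', IsOpen U' ∧ f '' (W ∩ halfSpace d hd) = M ∩ U')

/-- `p` is a boundary point of the submanifold `M`: some local parametrization as above
maps a point on the boundary of the half-space to `p`. -/
def IsBoundaryPoint {n : ℕ} (d : ℕ) (hd : 0 < d) (M : Set (EuclideanSpace ℂ (Fin n)))
    (p : EuclideanSpace ℂ (Fin n)) : Prop :=
  p ∈ M ∧ ∃ (V : Set (EuclideanSpace ℝ (Fin d))) (U : Set (EuclideanSpace ℂ (Fin n)))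
    (f : EuclideanSpace ℝ (Fin d) → EuclideanSpace ℂ (Fin n)),
    IsOpen V ∧ IsOpen U ∧ p ∈ U ∧ ContDiffOn ℝ (⊤ : ℕ∞) f V ∧
    Set.InjOn f (V ∩ halfSpace d hd) ∧
    (∀ x ∈ V, Function.Injective (fderiv ℝ f x)) ∧
    f '' (V ∩ halfSpace d hd) = M ∩ U ∧
    (∀ W, IsOpen W → W ⊆ V → ∃ U', IsOpen U' ∧ f '' (W ∩ halfSpace d hd) = M ∩ U') ∧
    ∃ x ∈ V ∩ halfSpace d hd, f x = p ∧ x ⟨0, hd⟩ = 0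

/-- The tangent space of `M ⊆ ℂ^n` at `p`, as a real subspace of `ℂ^n`. -/
def tangentSpaceAt {n : ℕ} (M : Set (EuclideanSpace ℂ (Fin n)))
    (p : EuclideanSpace ℂ (Fin n)) : Submodule ℝ (EuclideanSpace ℂ (Fin n)) :=
  Submodule.span ℝ (tangentConeAt ℝ M p)

/-- `M` is totally real at `p`: `T_pM ∩ i·T_pM = {0}`. -/
def TotallyRealAt {n : ℕ} (M : Set (EuclideanSpace ℂ (Fin n)))
    (p : EuclideanSpace ℂ (Fin n)) : Prop :=
  ∀ v ∈ tangentSpaceAt M p, Complex.I • v ∈ tangentSpaceAt M p → v = (0 : EuclideanSpace ℂ (Fin n))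

/-- The Beloshapka–Coffman normal form `𝓜_k ⊆ ℂ^{3k-1}`, in coordinates
`Z = (z, w₁, …, w_{2k-2}, ζ₁, …, ζ_k)`, `w_τ = u_τ + i v_τ`. -/
def bcForm (k : ℕ) (hk : 1 < k) : Set (EuclideanSpace ℂ (Fin (3*k-1))) :=
  {Z | (∀ τ : ℕ, ∀ _h1 : 1 ≤ τ, ∀ _h2 : τ ≤ 2*k-2, (Z ⟨τ, by omega⟩).im = 0) ∧
    Z ⟨2*k-1, by omega⟩ = (Complex.normSq (Z ⟨0, by omega⟩) : ℂ) +
      conj (Z ⟨0, by omega⟩) * (((Z ⟨1, by omega⟩).re : ℂ) + Complex.I * ((Z ⟨2, by omega⟩).re : ℂ)) ∧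
    (∀ σ : ℕ, ∀ _h1 : 2 ≤ σ, ∀ _h2 : σ ≤ k-1,
      Z ⟨2*k-2+σ, by omega⟩ = conj (Z ⟨0, by omega⟩) *
        (((Z ⟨2*σ-1, by omega⟩).re : ℂ) + Complex.I * ((Z ⟨2*σ, by omega⟩).re : ℂ))) ∧
    Z ⟨3*k-2, by omega⟩ = (conj (Z ⟨0, by omega⟩))^2}

/-- `p` is a generic CR-singularity of `M ⊆ ℂ^{3k-1}`: `(M, p)` is locally biholomorphic
to `(𝓜_k, O)`. -/
def IsGenericCRSingularity (k : ℕ) (hk : 1 < k) (M : Set (EuclideanSpace ℂ (Fin (3*k-1))))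
    (p : EuclideanSpace ℂ (Fin (3*k-1))) : Prop :=
  ∃ (U V : Set (EuclideanSpace ℂ (Fin (3*k-1))))
    (Φ Ψ : EuclideanSpace ℂ (Fin (3*k-1)) → EuclideanSpace ℂ (Fin (3*k-1))),
    IsOpen U ∧ IsOpen V ∧ p ∈ U ∧ (0 : EuclideanSpace ℂ (Fin (3*k-1))) ∈ V ∧
    DifferentiableOn ℂ Φ U ∧ DifferentiableOn ℂ Ψ V ∧
    Set.MapsTo Φ U V ∧ Set.MapsTo Ψ V U ∧
    (∀ x ∈ U, Ψ (Φ x) = x) ∧ (∀ y ∈ V, Φ (Ψ y) = y) ∧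
    Φ p = 0 ∧ Φ '' (M ∩ U) = bcForm k hk ∩ V

/-- The Laplacian at `0` of the slice function `λ ↦ ρ(p + λ·v)`. -/
def sliceLaplacian {n : ℕ} (ρ : EuclideanSpace ℂ (Fin n) → ℝ)
    (p v : EuclideanSpace ℂ (Fin n)) : ℝ :=
  iteratedFDeriv ℝ 2 (fun lam : ℂ => ρ (p + lam • v)) 0 ![1, 1]
  + iteratedFDeriv ℝ 2 (fun lam : ℂ => ρ (p + lam • v)) 0 ![Complex.I, Complex.I]

/-- `ρ` is plurisubharmonic on `U`. -/
def PshOn {n : ℕ} (ρ : EuclideanSpace ℂ (Fin n) → ℝ) (U : Set (EuclideanSpace ℂ (Fin n))) : Prop :=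
  ∀ p ∈ U, ∀ v : EuclideanSpace ℂ (Fin n), 0 ≤ sliceLaplacian ρ p v

/-- `ρ` is strictly plurisubharmonic at `p`. -/
def StrictPshAt {n : ℕ} (ρ : EuclideanSpace ℂ (Fin n) → ℝ)
    (p : EuclideanSpace ℂ (Fin n)) : Prop :=
  ∀ v : EuclideanSpace ℂ (Fin n), v ≠ 0 → 0 < sliceLaplacian ρ p v

/-- `ρ` is strictly plurisubharmonic on a set. -/
def StrictPshOn {n : ℕ} (ρ : EuclideanSpace ℂ (Fin n) → ℝ)
    (U : Set (EuclideanSpace ℂ (Fin n))) : Prop :=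
  ∀ p ∈ U, StrictPshAt ρ p

section WeightedLaurent

open LaurentPolynomial

variable {A : Type*} [NormedCommRing A]

/-- The weighted `ℓ¹` norm `∑ ‖aₙ‖ ρ^|n|` of a Laurent polynomial. -/
def laurentNorm (ρ : ℝ) (p : A[T;T⁻¹]) : ℝ :=
  p.coeff.sum fun n a => ‖a‖ * ρ ^ n.natAbs

lemma laurentNorm_single (ρ : ℝ) (n : ℤ) (a : A) :
    laurentNorm ρ (AddMonoidAlgebra.single n a) = ‖a‖ * ρ ^ n.natAbs := by
  rw [laurentNorm, AddMonoidAlgebra.coeff_single, Finsupp.sum_single_index (by simp)]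

lemma laurentNorm_neg (ρ : ℝ) (p : A[T;T⁻¹]) : laurentNorm ρ (-p) = laurentNorm ρ p := by
  unfold laurentNorm
  rw [AddMonoidAlgebra.coeff_neg, Finsupp.sum_neg_index (by simp)]
  simp

lemma laurentNorm_eq_sum {ρ : ℝ} {p : A[T;T⁻¹]} {s : Finset ℤ} (hs : p.coeff.support ⊆ s) :
    laurentNorm ρ p = ∑ n ∈ s, ‖p.coeff n‖ * ρ ^ n.natAbs :=
  Finsupp.sum_of_support_subset _ hs _ (by simp)

lemma laurentNorm_add_le {ρ : ℝ} (hρ : 0 ≤ ρ) (p q : A[T;T⁻¹]) :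
    laurentNorm ρ (p + q) ≤ laurentNorm ρ p + laurentNorm ρ q := by
  classical
  set s := p.coeff.support ∪ q.coeff.support
  have hpq : (p + q).coeff.support ⊆ s := by
    rw [AddMonoidAlgebra.coeff_add]; exact Finsupp.support_add
  rw [laurentNorm_eq_sum hpq, laurentNorm_eq_sum (Finset.subset_union_left : _ ⊆ s),
    laurentNorm_eq_sum (Finset.subset_union_right : _ ⊆ s), ← Finset.sum_add_distrib]
  refine Finset.sum_le_sum fun n _ => ?_
  rw [← add_mul]
  gcongr
  exact norm_add_le _ _

lemma laurentNorm_sum_le {ρ : ℝ} (hρ : 0 ≤ ρ) {ι : Type*} (s : Finset ι) (f : ι → A[T;T⁻¹]) :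
    laurentNorm ρ (∑ i ∈ s, f i) ≤ ∑ i ∈ s, laurentNorm ρ (f i) :=
  Finset.le_sum_of_subadditive _ (by simp [laurentNorm]) (laurentNorm_add_le hρ) _ _

lemma laurentNorm_mul_le {ρ : ℝ} (hρ : 1 ≤ ρ) (p q : A[T;T⁻¹]) :
    laurentNorm ρ (p * q) ≤ laurentNorm ρ p * laurentNorm ρ q := by
  have hρ0 : 0 ≤ ρ := zero_le_one.trans hρ
  rw [AddMonoidAlgebra.mul_def]
  refine (laurentNorm_sum_le hρ0 _ _).trans ?_
  rw [laurentNorm, Finsupp.sum, Finset.sum_mul]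
  refine Finset.sum_le_sum fun n _ => (laurentNorm_sum_le hρ0 _ _).trans ?_
  rw [laurentNorm, Finsupp.sum, Finset.mul_sum]
  refine Finset.sum_le_sum fun m _ => ?_
  rw [laurentNorm_single]
  calc ‖p.coeff n * q.coeff m‖ * ρ ^ (n + m).natAbs
      ≤ (‖p.coeff n‖ * ‖q.coeff m‖) * (ρ ^ n.natAbs * ρ ^ m.natAbs) := by
        gcongr
        · exact norm_mul_le _ _
        · rw [← pow_add]
          exact pow_le_pow_right₀ hρ (Int.natAbs_add_le n m)
    _ = _ := by ring

/-- Laurent polynomials with the weighted `ℓ¹` norm form a seminormed ring. -/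
abbrev laurentSeminormedCommRing {ρ : ℝ} (hρ : 1 ≤ ρ) : SeminormedCommRing (A[T;T⁻¹]) :=
  let g : SeminormedAddCommGroup (A[T;T⁻¹]) := AddGroupSeminorm.toSeminormedAddCommGroup
    { toFun := laurentNorm ρ
      map_zero' := by simp [laurentNorm]
      add_le' := laurentNorm_add_le (zero_le_one.trans hρ)
      neg' := laurentNorm_neg ρ }
  { g, (inferInstance : CommRing (A[T;T⁻¹])) with
    norm_mul_le := laurentNorm_mul_le hρ }

/-- The value at `τ` of the part of a Laurent polynomial with exponents in `s`. -/
def partialEval [NormedAlgebra ℂ A] (χ : A →ₐ[ℂ] ℂ) (τ : ℂ) (s : Set ℤ) [DecidablePred (· ∈ s)]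
    (p : A[T;T⁻¹]) : ℂ :=
  p.coeff.sum fun n a => if n ∈ s then χ a * τ ^ n else 0

variable [NormedAlgebra ℂ A] {χ : A →ₐ[ℂ] ℂ} {τ : ℂ} {s : Set ℤ} [DecidablePred (· ∈ s)]

lemma partialEval_add (p q : A[T;T⁻¹]) :
    partialEval χ τ s (p + q) = partialEval χ τ s p + partialEval χ τ s q := by
  unfold partialEval
  rw [AddMonoidAlgebra.coeff_add]
  refine Finsupp.sum_add_index' (by simp) fun n a b => ?_
  split_ifs <;> simp [add_mul]

lemma partialEval_single (n : ℤ) (a : A) :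
    partialEval χ τ s (AddMonoidAlgebra.single n a) = if n ∈ s then χ a * τ ^ n else 0 := by
  rw [partialEval, AddMonoidAlgebra.coeff_single, Finsupp.sum_single_index (by simp)]

lemma partialEval_sub (p q : A[T;T⁻¹]) :
    partialEval χ τ s (p - q) = partialEval χ τ s p - partialEval χ τ s q := by
  rw [eq_sub_iff_add_eq, ← partialEval_add, sub_add_cancel]

lemma norm_partialEval_le {ρ : ℝ} (hχ : ∀ a, ‖χ a‖ ≤ ‖a‖) (hτ : ∀ n ∈ s, ‖τ ^ n‖ ≤ ρ ^ n.natAbs)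
    (hρ : 0 ≤ ρ) (p : A[T;T⁻¹]) : ‖partialEval χ τ s p‖ ≤ laurentNorm ρ p := by
  refine (norm_sum_le _ _).trans (Finset.sum_le_sum fun n _ => ?_)
  dsimp only
  split_ifs with hn
  · rw [norm_mul]
    exact mul_le_mul (hχ _) (hτ n hn) (norm_nonneg _) (norm_nonneg _)
  · rw [norm_zero]; positivity

/-- Telescoping: the nonnegative part of `(T - h) K`, evaluated at `χ h`, is the coefficient of
`T⁻¹` in `K`. -/
lemma partialEval_nonneg_sub_mul (h : A) (K : A[T;T⁻¹]) :
    partialEval χ (χ h) {n : ℤ | 0 ≤ n} ((T 1 - C h) * K) = χ (K.coeff (-1)) := by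
  induction K using AddMonoidAlgebra.induction_linear with
  | zero => simp [partialEval]
  | add f g hf hg => rw [mul_add, partialEval_add, hf, hg]; simp
  | single n a =>
    rw [sub_mul, partialEval_sub, ← single_eq_C, T, AddMonoidAlgebra.single_mul_single,
      AddMonoidAlgebra.single_mul_single, partialEval_single, partialEval_single]
    simp only [Set.mem_ofPred_eq, zero_add, one_mul, map_mul, AddMonoidAlgebra.coeff_single]
    rcases lt_trichotomy n (-1) with hn | rfl | hn
    · rw [if_neg (by omega), if_neg (by omega), Finsupp.single_eq_of_ne (by omega)]; simp
    · simp
    · obtain ⟨m, rfl⟩ := Int.eq_ofNat_of_zero_le (show 0 ≤ n by omega)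
      rw [if_pos (by omega), if_pos (by omega), Finsupp.single_eq_of_ne (by omega), add_comm]
      norm_cast
      rw [pow_succ]; simp; ring

lemma partialEval_neg_sub_mul (h : A) (hh : χ h ≠ 0) (K : A[T;T⁻¹]) :
    partialEval χ (χ h) {n : ℤ | n < 0} ((T 1 - C h) * K) = -χ (K.coeff (-1)) := by
  induction K using AddMonoidAlgebra.induction_linear with
  | zero => simp [partialEval]
  | add f g hf hg => rw [mul_add, partialEval_add, hf, hg]; simp; ring
  | single n a =>
    rw [sub_mul, partialEval_sub, ← single_eq_C, T, AddMonoidAlgebra.single_mul_single,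
      AddMonoidAlgebra.single_mul_single, partialEval_single, partialEval_single]
    simp only [Set.mem_ofPred_eq, zero_add, one_mul, map_mul, AddMonoidAlgebra.coeff_single]
    rcases lt_trichotomy n (-1) with hn | rfl | hn
    · rw [if_pos (by omega), if_pos (by omega), Finsupp.single_eq_of_ne (by omega), add_comm,
        zpow_add_one₀ hh, map_zero]
      ring
    · simp; field_simp
    · rw [if_neg (by omega), if_neg (by omega), Finsupp.single_eq_of_ne (by omega)]; simp

end WeightedLaurent

section AnnulusAlgebra

open LaurentPolynomial

/-- For an element `h` of a commutative normed algebra `A` there is a Banach algebra `B` receiving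
`A`, in which `h` becomes invertible with `‖h‖, ‖h⁻¹‖ ≤ ρ`, and such that an element `f` of `A`
that is small in `B` can be split: some `F ∈ A` is close to `f` where `|h| ≤ ρ` and close to
`0` where `|h| ≥ ρ⁻¹`. -/
theorem exists_annulus_algebra.{u} {A : Type u} [NormedCommRing A] [NormedAlgebra ℂ A]
    [NormOneClass A]
    (h : A) {ρ : ℝ} (hρ : 1 ≤ ρ) :
    ∃ (B : Type u) (_ : NormedCommRing B) (_ : NormedAlgebra ℂ B) (_ : CompleteSpace B)
      (ι : A →ₐ[ℂ] B) (v : B), (∀ a, ‖ι a‖ ≤ ‖a‖) ∧ ‖ι h‖ ≤ ρ ∧ ι h * v = 1 ∧ ‖v‖ ≤ ρ ∧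
      ∀ (f : A) (δ : ℝ), ‖ι f‖ < δ → ∃ F : A, ∀ χ : A →ₐ[ℂ] ℂ, (∀ a, ‖χ a‖ ≤ ‖a‖) →
        (‖χ h‖ ≤ ρ → ‖χ F - χ f‖ ≤ δ) ∧ (ρ⁻¹ ≤ ‖χ h‖ → ‖χ F‖ ≤ δ) := by
  have hρ0 : 0 < ρ := zero_lt_one.trans_le hρ
  let _ : SeminormedCommRing (A[T;T⁻¹]) := laurentSeminormedCommRing hρ
  let _ : NormedAlgebra ℂ (A[T;T⁻¹]) :=
    { (inferInstance : Algebra ℂ (A[T;T⁻¹])) with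
      norm_smul_le := fun c p => by
        change laurentNorm ρ (c • p) ≤ ‖c‖ * laurentNorm ρ p
        have hs : (c • p).coeff.support ⊆ p.coeff.support := Finsupp.support_smul
        rw [laurentNorm_eq_sum hs, laurentNorm, Finsupp.sum, Finset.mul_sum]
        refine Finset.sum_le_sum fun n _ => ?_
        rw [AddMonoidAlgebra.coeff_smul_apply, norm_smul, mul_assoc] }
  let I : Ideal (A[T;T⁻¹]) := Ideal.span {T 1 - C h}
  have hle : ∀ p : A[T;T⁻¹], ‖Ideal.Quotient.mk I p‖ ≤ laurentNorm ρ p :=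
    Ideal.Quotient.norm_mk_le I
  have hT : Ideal.Quotient.mk I (C h) = Ideal.Quotient.mk I (T 1) := by
    rw [eq_comm, Ideal.Quotient.eq]; exact Ideal.subset_span rfl
  have hnT : ∀ n : ℤ, laurentNorm ρ (T n : A[T;T⁻¹]) = ρ ^ n.natAbs := fun n => by
    rw [T, laurentNorm_single, norm_one, one_mul]
  let coe : (A[T;T⁻¹] ⧸ I) →ₐ[ℂ] UniformSpace.Completion (A[T;T⁻¹] ⧸ I) :=
    { UniformSpace.Completion.coeRingHom with commutes' := fun _ => rfl }
  have hcoe : ∀ x, ‖coe x‖ = ‖x‖ := UniformSpace.Completion.norm_coe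
  let ι := (coe.comp (Ideal.Quotient.mkₐ ℂ I)).comp (IsScalarTower.toAlgHom ℂ A (A[T;T⁻¹]))
  have hι : ∀ a, ι a = coe (Ideal.Quotient.mk I (C a)) := fun _ => rfl
  refine ⟨UniformSpace.Completion (A[T;T⁻¹] ⧸ I), inferInstance, inferInstance, inferInstance,
    ι, coe (Ideal.Quotient.mk I (T (-1))), fun a => ?_, ?_, ?_, ?_, fun f δ hf => ?_⟩
  · rw [hι, hcoe]
    refine (hle _).trans_eq ?_
    rw [← single_eq_C, laurentNorm_single]; simp
  · rw [hι, hcoe, hT]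
    refine (hle _).trans_eq ?_
    simp [hnT]
  · rw [hι, hT, ← map_mul, ← map_mul, ← T_add]; simp
  · rw [hcoe]
    refine (hle _).trans_eq ?_
    simp [hnT]
  · rw [hι, hcoe] at hf
    obtain ⟨G, hG, hGδ⟩ := Ideal.Quotient.norm_mk_lt (Ideal.Quotient.mk I (C f)) (sub_pos.2 hf)
    replace hGδ : laurentNorm ρ G < δ := hGδ.trans_eq (add_sub_cancel _ _)
    obtain ⟨K, hK⟩ := Ideal.mem_span_singleton'.1 (Ideal.Quotient.eq.1 hG.symm)
    have hfG : C f - G = (T 1 - C h) * K := by rw [← hK, mul_comm]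
    refine ⟨K.coeff (-1), fun χ hχ => ⟨fun hh => ?_, fun hh => ?_⟩⟩
    · have key := partialEval_nonneg_sub_mul (χ := χ) h K
      rw [← hfG, partialEval_sub, ← single_eq_C, partialEval_single] at key
      have hG' : ‖partialEval χ (χ h) {n : ℤ | 0 ≤ n} G‖ ≤ laurentNorm ρ G := by
        refine norm_partialEval_le hχ (fun n hn => ?_) hρ0.le G
        obtain ⟨m, rfl⟩ := Int.eq_ofNat_of_zero_le hn
        simpa using pow_le_pow_left₀ (norm_nonneg _) hh m
      rw [← key]
      simpa using hG'.trans hGδ.le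
    · have hχh : 0 < ‖χ h‖ := (inv_pos.2 hρ0).trans_le hh
      have key := partialEval_neg_sub_mul (χ := χ) h (norm_pos_iff.1 hχh) K
      rw [← hfG, partialEval_sub, ← single_eq_C, partialEval_single] at key
      have hG' : ‖partialEval χ (χ h) {n : ℤ | n < 0} G‖ ≤ laurentNorm ρ G := by
        refine norm_partialEval_le hχ (fun n hn => ?_) hρ0.le G
        obtain ⟨m, rfl⟩ := Int.exists_eq_neg_ofNat (le_of_lt hn)
        simpa using pow_le_pow_left₀ (by positivity) (inv_le_of_inv_le₀ hρ0 hh) m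
      rw [← norm_neg, ← key]
      simpa using hG'.trans hGδ.le

end AnnulusAlgebra

section PolynomialAlgebra

open Filter Topology

/-- An element of spectral radius less than one is topologically nilpotent. -/
lemma tendsto_norm_pow_of_spectralRadius_lt_one {B : Type*} [NormedRing B] [NormedAlgebra ℂ B]
    [CompleteSpace B] {b : B} (hb : spectralRadius ℂ b < 1) :
    Tendsto (fun m : ℕ => ‖b ^ m‖) atTop (𝓝 0) := by
  obtain ⟨c, hc, hc1⟩ := ENNReal.lt_iff_exists_nnreal_btwn.1 hb
  have hc1' : (c : ℝ) < 1 := by exact_mod_cast hc1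
  refine squeeze_zero' (Eventually.of_forall fun _ => norm_nonneg _) ?_
    (tendsto_pow_atTop_nhds_zero_of_lt_one c.2 hc1')
  filter_upwards [(spectrum.pow_nnnorm_pow_one_div_tendsto_nhds_spectralRadius b).eventually_lt_const
    hc, eventually_gt_atTop 0] with m hm hm0
  have hm' : (0 : ℝ) < m := by exact_mod_cast hm0
  rw [one_div, ENNReal.rpow_inv_lt_iff hm', ENNReal.rpow_natCast] at hm
  exact_mod_cast hm.le

variable {n : ℕ}

lemma continuous_evalPoly (P : MvPolynomial (Fin n) ℂ) : Continuous (evalPoly P) := by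
  unfold evalPoly
  simp only [MvPolynomial.eval_eq]
  fun_prop

/-- Description of the polynomial hull of a compact set by upper bounds. -/
lemma mem_polyHull_iff {K : Set (EuclideanSpace ℂ (Fin n))} (hK : IsCompact K)
    {z : EuclideanSpace ℂ (Fin n)} :
    z ∈ polyHull K ↔ ∀ (P : MvPolynomial (Fin n) ℂ) (c : ℝ),
      (∀ w ∈ K, ‖evalPoly P w‖ ≤ c) → ‖evalPoly P z‖ ≤ c := by
  refine ⟨fun hz P c hc => ?_, fun hz P => hz P _ fun w hw => ?_⟩
  · rcases K.eq_empty_or_nonempty with rfl | ⟨w, hw⟩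
    · exact absurd (hz 1) (by simp [evalPoly])
    · have hc0 : 0 ≤ c := (norm_nonneg _).trans (hc w hw)
      exact (hz P).trans (Real.iSup_le (fun w => Real.iSup_le (fun hw => hc w hw) hc0) hc0)
  · obtain ⟨c, hc⟩ := (hK.image (continuous_evalPoly P).norm).bddAbove
    have hc' : ∀ w ∈ K, ‖evalPoly P w‖ ≤ c := fun w hw => hc ⟨w, hw, rfl⟩
    have hc0 : 0 ≤ c := (norm_nonneg _).trans (hc' w hw)
    refine le_ciSup_of_le (f := fun w => ⨆ _ : w ∈ K, ‖evalPoly P w‖) ⟨c, ?_⟩ w ?_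
    · rintro _ ⟨w, rfl⟩
      exact Real.iSup_le (fun hw => hc' w hw) hc0
    · rw [ciSup_pos hw]

lemma subset_polyHull {K : Set (EuclideanSpace ℂ (Fin n))} (hK : IsCompact K) :
    K ⊆ polyHull K := fun _ hz => (mem_polyHull_iff hK).2 fun _ _ hc => hc _ hz

/-- Cutting a polynomially convex compact set by a polynomial inequality preserves polynomial
convexity. -/
lemma IsPolyConvex.inter_le {K : Set (EuclideanSpace ℂ (Fin n))} (hK : IsCompact K)
    (hpc : IsPolyConvex K) (P : MvPolynomial (Fin n) ℂ) (r : ℝ) :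
    IsPolyConvex (K ∩ {z | ‖evalPoly P z‖ ≤ r}) := by
  have hc : IsCompact (K ∩ {z | ‖evalPoly P z‖ ≤ r}) :=
    hK.inter_right (isClosed_le (continuous_evalPoly P).norm continuous_const)
  refine Set.Subset.antisymm (fun z hz => ?_) (subset_polyHull hc)
  rw [mem_polyHull_iff hc] at hz
  refine ⟨?_, hz P r fun w hw => hw.2⟩
  rw [← hpc, mem_polyHull_iff hK]
  exact fun Q c hQ => hz Q c fun w hw => hQ w hw.1

variable (X : Set (EuclideanSpace ℂ (Fin n)))

/-- Restriction of polynomials to `X`. -/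
def polyRestrict : MvPolynomial (Fin n) ℂ →ₐ[ℂ] C(X, ℂ) :=
  MvPolynomial.aeval fun i => ⟨fun x => x.1 i, by fun_prop⟩

variable {X}

@[simp]
lemma polyRestrict_apply (P : MvPolynomial (Fin n) ℂ) (x : X) :
    polyRestrict X P x = evalPoly P x := by
  induction P using MvPolynomial.induction_on with
  | C a => simp [polyRestrict, evalPoly]
  | add p q hp hq => rw [map_add, ContinuousMap.add_apply, hp, hq]; simp [evalPoly]
  | mul_X p i hp =>
    rw [map_mul, ContinuousMap.mul_apply, hp]; simp [evalPoly, polyRestrict]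

variable (X) [CompactSpace X]

/-- The uniform closure `𝒫(X)` of the polynomials in `C(X)`. -/
def polyClosure : Subalgebra ℂ C(X, ℂ) := (polyRestrict X).range.topologicalClosure

/-- A polynomial as an element of `𝒫(X)`. -/
def toPolyClosure : MvPolynomial (Fin n) ℂ →ₐ[ℂ] polyClosure X :=
  (polyRestrict X).codRestrict _ fun P =>
    Subalgebra.le_topologicalClosure _ (AlgHom.mem_range_self _ P)

variable {X}

@[simp]
lemma toPolyClosure_apply (P : MvPolynomial (Fin n) ℂ) (x : X) :
    (toPolyClosure X P : C(X, ℂ)) x = evalPoly P x := polyRestrict_apply P x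

lemma denseRange_toPolyClosure : DenseRange (toPolyClosure X) := by
  intro a
  refine (closure_subtype (p := (· ∈ polyClosure X))).2 ?_
  have : Subtype.val '' Set.range (toPolyClosure X) = ((polyRestrict X).range : Set C(X, ℂ)) := by
    rw [← Set.range_comp]; rfl
  rw [this]
  exact a.2

lemma exists_evalPoly_near (a : polyClosure X) {ε : ℝ} (hε : 0 < ε) :
    ∃ P : MvPolynomial (Fin n) ℂ, ∀ x : X, ‖(a : C(X, ℂ)) x - evalPoly P x‖ < ε := by
  obtain ⟨P, hP⟩ := Metric.denseRange_iff.1 denseRange_toPolyClosure a ε hε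
  refine ⟨P, fun x => ?_⟩
  rw [← toPolyClosure_apply, ← dist_eq_norm]
  exact (ContinuousMap.dist_apply_le_dist x).trans_lt hP

instance : CompleteSpace (polyClosure X) :=
  (Subalgebra.isClosed_topologicalClosure _).completeSpace_coe

/-- Every contractive character of `𝒫(X)` is a point evaluation when `X` is polynomially
convex. -/
lemma exists_eq_eval (hpc : IsPolyConvex X) (χ : polyClosure X →ₐ[ℂ] ℂ)
    (hχ : ∀ a, ‖χ a‖ ≤ ‖a‖) : ∃ x : X, ∀ a : polyClosure X, χ a = (a : C(X, ℂ)) x := by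
  set z : EuclideanSpace ℂ (Fin n) := WithLp.toLp 2 fun i => χ (toPolyClosure X (.X i)) with hz
  have hP : ∀ P, χ (toPolyClosure X P) = evalPoly P z := fun P => by
    have : χ.comp (toPolyClosure X) = MvPolynomial.aeval fun i => z i := by ext; simp [hz]
    exact DFunLike.congr_fun this P
  have hzX : z ∈ X := by
    rw [← hpc, mem_polyHull_iff (isCompact_iff_compactSpace.2 ‹_›)]
    intro P c hc
    have hX : (X : Set _).Nonempty := by
      by_contra hX
      have : IsEmpty X := Set.isEmpty_coe_sort.2 (Set.not_nonempty_iff_eq_empty.1 hX)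
      have : (1 : polyClosure X) = 0 := Subtype.ext (ContinuousMap.ext fun x => isEmptyElim x)
      exact one_ne_zero ((map_one χ).symm.trans ((congrArg χ this).trans (map_zero χ)))
    obtain ⟨w, hw⟩ := hX
    rw [← hP]
    refine (hχ _).trans ?_
    refine (ContinuousMap.norm_le _ ((norm_nonneg _).trans (hc w hw))).2 fun x => ?_
    exact (congrArg norm (toPolyClosure_apply P x)).trans_le (hc x x.2)
  refine ⟨⟨z, hzX⟩, fun a => ?_⟩
  have h1 : Continuous χ := AddMonoidHomClass.continuous_of_bound χ 1 fun a => by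
    rw [one_mul]; exact hχ a
  have h2 : Continuous fun a : polyClosure X => (a : C(X, ℂ)) ⟨z, hzX⟩ :=
    (ContinuousEvalConst.continuous_eval_const _).comp continuous_subtype_val
  exact congrFun (denseRange_toPolyClosure.equalizer h1 h2 (funext fun P =>
    (hP P).trans (toPolyClosure_apply P ⟨z, hzX⟩).symm)) a

/-- Over the annulus `r₁ ≤ |h| ≤ r₂` there is a Banach algebra in which elements of `𝒫(X)` smaller
than one on the annulus are topologically nilpotent, and such that elements which are small in it
can be cut off outside `|h| ≤ r₂`. -/
theorem exists_cutoff_algebra (hpc : IsPolyConvex X) [Nonempty X] (h : polyClosure X) {r₁ r₂ : ℝ}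
    (h₁ : 0 < r₁) (h₁₂ : r₁ ≤ r₂) :
    ∃ (B : Type) (_ : NormedCommRing B) (_ : NormedAlgebra ℂ B) (_ : CompleteSpace B)
      (ι : polyClosure X →ₐ[ℂ] B), (∀ a, ‖ι a‖ ≤ ‖a‖) ∧
      (∀ f : polyClosure X, (∀ x : X, r₁ ≤ ‖(h : C(X, ℂ)) x‖ → ‖(h : C(X, ℂ)) x‖ ≤ r₂ →
        ‖(f : C(X, ℂ)) x‖ < 1) → Tendsto (fun m : ℕ => ‖ι f ^ m‖) atTop (𝓝 0)) ∧
      ∀ (f : polyClosure X) (δ : ℝ), ‖ι f‖ < δ → ∃ F : polyClosure X, ∀ x : X,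
        (‖(h : C(X, ℂ)) x‖ ≤ r₂ → ‖(F : C(X, ℂ)) x - (f : C(X, ℂ)) x‖ ≤ δ) ∧
        (r₁ ≤ ‖(h : C(X, ℂ)) x‖ → ‖(F : C(X, ℂ)) x‖ ≤ δ) := by
  have h₂ : 0 < r₂ := h₁.trans_le h₁₂
  set ρ := √(r₂ / r₁) with hρ
  set s := √(r₁ * r₂) with hs
  have hs0 : 0 < s := Real.sqrt_pos.2 (by positivity)
  have hρ1 : 1 ≤ ρ := Real.one_le_sqrt.2 ((one_le_div h₁).2 h₁₂)
  have hρ0 : 0 < ρ := zero_lt_one.trans_le hρ1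
  have hsρ : s * ρ = r₂ := by
    rw [hs, hρ, ← Real.sqrt_mul (by positivity),
      show r₁ * r₂ * (r₂ / r₁) = r₂ ^ 2 by field_simp, Real.sqrt_sq h₂.le]
  have hsρ' : s * ρ⁻¹ = r₁ := by
    rw [hs, hρ, ← Real.sqrt_inv, ← Real.sqrt_mul (by positivity),
      show r₁ * r₂ * (r₂ / r₁)⁻¹ = r₁ ^ 2 by field_simp, Real.sqrt_sq h₁.le]
  have e1 : ∀ c : ℂ, ‖(s⁻¹ : ℂ) * c‖ ≤ ρ ↔ ‖c‖ ≤ r₂ := fun c => by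
    rw [norm_mul, norm_inv, Complex.norm_real, Real.norm_of_nonneg hs0.le, inv_mul_le_iff₀ hs0,
      hsρ]
  have e2 : ∀ c : ℂ, ρ⁻¹ ≤ ‖(s⁻¹ : ℂ) * c‖ ↔ r₁ ≤ ‖c‖ := fun c => by
    rw [norm_mul, norm_inv, Complex.norm_real, Real.norm_of_nonneg hs0.le, le_inv_mul_iff₀ hs0,
      hsρ']
  have : NormOneClass (polyClosure X) := ⟨(norm_one : ‖(1 : C(X, ℂ))‖ = 1)⟩
  obtain ⟨B, _, _, _, ι, v, hι, hιh, hv, hnv, hF⟩ :=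
    exists_annulus_algebra ((s⁻¹ : ℂ) • h) hρ1
  refine ⟨B, inferInstance, inferInstance, inferInstance, ι, hι, fun f hf => ?_, fun f δ hfδ => ?_⟩
  · rcases subsingleton_or_nontrivial B with hB | hB
    · simp [Subsingleton.elim _ (0 : B)]
    have h1 : ‖(1 : B)‖ ≤ 1 := by simpa using hι 1
    have hφ : ∀ φ : WeakDual.characterSpace ℂ B, ∀ b, ‖φ b‖ ≤ ‖b‖ := fun φ b => by
      have := spectrum.norm_le_norm_mul_of_mem (AlgHom.apply_mem_spectrum φ b)
      exact this.trans (mul_le_of_le_one_right (norm_nonneg _) h1)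
    have hlt : spectralRadius ℂ (ι f) < 1 := by
      refine spectrum.spectralRadius_lt_of_forall_lt (r := 1) (ι f) fun c hc => ?_
      obtain ⟨φ, rfl⟩ := WeakDual.CharacterSpace.mem_spectrum_iff_exists.1 hc
      let χ : polyClosure X →ₐ[ℂ] ℂ := (WeakDual.CharacterSpace.toAlgHom φ).comp ι
      obtain ⟨x, hx⟩ := exists_eq_eval hpc χ fun a => (hφ φ _).trans (hι a)
      have hχh := hx ((s⁻¹ : ℂ) • h)
      have hφh : φ (ι ((s⁻¹ : ℂ) • h)) = (s⁻¹ : ℂ) * (h : C(X, ℂ)) x := hχh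
      have hφf : φ (ι f) = (f : C(X, ℂ)) x := hx f
      rw [← NNReal.coe_lt_coe, coe_nnnorm, hφf]
      refine hf x ((e2 _).1 ?_) ((e1 _).1 ?_)
      · rw [← hφh]
        have hmul : φ (ι ((s⁻¹ : ℂ) • h)) * φ v = 1 := by rw [← map_mul, hv, map_one]
        have hnm : ‖φ (ι ((s⁻¹ : ℂ) • h))‖ * ‖φ v‖ = 1 := by rw [← norm_mul, hmul, norm_one]
        rw [inv_le_iff_one_le_mul₀ hρ0, ← hnm]
        gcongr
        exact (hφ φ v).trans hnv
      · rw [← hφh]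
        exact (hφ φ _).trans hιh
    exact tendsto_norm_pow_of_spectralRadius_lt_one hlt
  · obtain ⟨F, hF⟩ := hF f δ hfδ
    refine ⟨F, fun x => ?_⟩
    let χ : polyClosure X →ₐ[ℂ] ℂ :=
      (ContinuousMap.evalAlgHom ℂ ℂ x).comp (polyClosure X).val
    have := hF χ fun a => ContinuousMap.norm_coe_le_norm (a : C(X, ℂ)) x
    exact ⟨fun hx => this.1 ((e1 _).2 hx), fun hx => this.2 ((e2 _).2 hx)⟩

end PolynomialAlgebra

section PeakPolynomial

open Filter Topology

variable {n : ℕ}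

lemma evalPoly_sub (P Q : MvPolynomial (Fin n) ℂ) (z : EuclideanSpace ℂ (Fin n)) :
    evalPoly (P - Q) z = evalPoly P z - evalPoly Q z := by simp [evalPoly]

lemma evalPoly_mul (P Q : MvPolynomial (Fin n) ℂ) (z : EuclideanSpace ℂ (Fin n)) :
    evalPoly (P * Q) z = evalPoly P z * evalPoly Q z := by simp [evalPoly]

lemma evalPoly_pow (P : MvPolynomial (Fin n) ℂ) (m : ℕ) (z : EuclideanSpace ℂ (Fin n)) :
    evalPoly (P ^ m) z = evalPoly P z ^ m := by simp [evalPoly]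

lemma evalPoly_C (c : ℂ) (z : EuclideanSpace ℂ (Fin n)) :
    evalPoly (.C c) z = c := by simp [evalPoly]

lemma evalPoly_X (i : Fin n) (z : EuclideanSpace ℂ (Fin n)) :
    evalPoly (.X i) z = z i := by simp [evalPoly]

lemma eventually_forall_norm_pow_le {K : Set (EuclideanSpace ℂ (Fin n))} (hK : IsCompact K)
    {F : MvPolynomial (Fin n) ℂ} (hF : ∀ z ∈ K, ‖evalPoly F z‖ < 1) {ε : ℝ} (hε : 0 < ε) :
    ∀ᶠ m : ℕ in atTop, ∀ z ∈ K, ‖evalPoly F z‖ ^ m ≤ ε := by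
  rcases K.eq_empty_or_nonempty with rfl | hne
  · simp
  obtain ⟨w, hw, hmax⟩ := hK.exists_isMaxOn hne (continuous_evalPoly F).norm.continuousOn
  filter_upwards [(tendsto_pow_atTop_nhds_zero_of_lt_one (norm_nonneg _)
    (hF w hw)).eventually_le_const hε] with m hm z hz
  exact (pow_le_pow_left₀ (norm_nonneg _) (hmax hz) m).trans hm

/-- Removal of one polynomial constraint `|h| ≤ r₂` from the domain of a peaking polynomial. -/
lemma exists_peak_of_peak_inter {K U : Set (EuclideanSpace ℂ (Fin n))} (hK : IsCompact K)
    (hpc : IsPolyConvex K) (hU : IsOpen U) {p : EuclideanSpace ℂ (Fin n)} (hp : p ∈ K)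
    {h : MvPolynomial (Fin n) ℂ} (hhp : evalPoly h p = 0) {r₁ r₂ : ℝ} (h₁ : 0 < r₁)
    (h₁₂ : r₁ ≤ r₂) (hUh : ∀ z ∈ U, ‖evalPoly h z‖ < r₁) {F : MvPolynomial (Fin n) ℂ}
    (hFp : evalPoly F p = 1)
    (hF : ∀ z ∈ K, ‖evalPoly h z‖ ≤ r₂ → z ∉ U → ‖evalPoly F z‖ < 1) :
    ∃ G : MvPolynomial (Fin n) ℂ, evalPoly G p = 1 ∧ ∀ z ∈ K, z ∉ U → ‖evalPoly G z‖ < 1 := by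
  have : CompactSpace K := isCompact_iff_compactSpace.1 hK
  have : Nonempty K := ⟨⟨p, hp⟩⟩
  obtain ⟨B, _, _, _, ι, -, hnil, hcut⟩ :=
    exists_cutoff_algebra hpc (toPolyClosure K h) h₁ h₁₂
  have hK' : IsCompact ((K ∩ {z | ‖evalPoly h z‖ ≤ r₂}) ∩ Uᶜ) :=
    (hK.inter_right (isClosed_le (continuous_evalPoly h).norm continuous_const)).inter_right
      hU.isClosed_compl
  have hnilF := hnil (toPolyClosure K F) fun x hx1 hx2 => by
    rw [toPolyClosure_apply] at *
    exact hF x x.2 hx2 fun hxU => (hUh x hxU).not_ge hx1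
  obtain ⟨m, hm1, hm2⟩ := ((hnilF.eventually_lt_const (show (0 : ℝ) < 1 / 8 by norm_num)).and
    (eventually_forall_norm_pow_le (F := F) hK' (fun z hz => hF z hz.1.1 hz.1.2 hz.2)
      (show (0 : ℝ) < 1 / 8 by norm_num))).exists
  obtain ⟨a, ha⟩ := hcut (toPolyClosure K (F ^ m)) (1 / 8) (by rwa [map_pow, map_pow])
  obtain ⟨P, hP⟩ := exists_evalPoly_near a (show (0 : ℝ) < 1 / 16 by norm_num)
  simp only [toPolyClosure_apply, evalPoly_pow] at ha
  have hPp : 13 / 16 ≤ ‖evalPoly P p‖ := by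
    have h1 := (ha ⟨p, hp⟩).1 (by simpa [hhp] using h₁.le.trans h₁₂)
    have h2 := hP ⟨p, hp⟩
    simp only [hFp, one_pow] at h1 h2
    have h3 : ‖(1 : ℂ)‖ ≤ ‖evalPoly P p‖ + ‖(a : C(K, ℂ)) ⟨p, hp⟩ - evalPoly P p‖ +
        ‖(a : C(K, ℂ)) ⟨p, hp⟩ - 1‖ := by
      calc ‖(1 : ℂ)‖ = ‖evalPoly P p + ((a : C(K, ℂ)) ⟨p, hp⟩ - evalPoly P p) -
            ((a : C(K, ℂ)) ⟨p, hp⟩ - 1)‖ := by ring_nf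
        _ ≤ _ := (norm_sub_le _ _).trans (by gcongr; exact norm_add_le _ _)
    rw [norm_one] at h3
    linarith
  have hPU : ∀ z ∈ K, z ∉ U → ‖evalPoly P z‖ ≤ 5 / 16 := fun z hz hzU => by
    have h2 := hP ⟨z, hz⟩
    have haz : ‖(a : C(K, ℂ)) ⟨z, hz⟩‖ ≤ 1 / 4 := by
      rcases le_total ‖evalPoly h z‖ r₂ with hle | hle
      · have h1 := (ha ⟨z, hz⟩).1 hle
        have h3 := hm2 z ⟨⟨hz, hle⟩, hzU⟩
        rw [← norm_pow] at h3
        have h4 := norm_add_le ((a : C(K, ℂ)) ⟨z, hz⟩ - evalPoly F z ^ m) (evalPoly F z ^ m)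
        rw [sub_add_cancel] at h4
        linarith
      · linarith [(ha ⟨z, hz⟩).2 (h₁₂.trans hle)]
    have h4 := norm_sub_le ((a : C(K, ℂ)) ⟨z, hz⟩)
      ((a : C(K, ℂ)) ⟨z, hz⟩ - evalPoly P z)
    rw [sub_sub_cancel] at h4
    linarith
  have hP0 : evalPoly P p ≠ 0 := norm_pos_iff.1 (by linarith)
  refine ⟨.C (evalPoly P p)⁻¹ * P, ?_, fun z hz hzU => ?_⟩
  · rw [evalPoly_mul, evalPoly_C, inv_mul_cancel₀ hP0]
  · rw [evalPoly_mul, evalPoly_C, norm_mul, norm_inv, inv_mul_lt_iff₀ (norm_pos_iff.2 hP0)]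
    linarith [hPU z hz hzU]

/-- A polynomial peaking on the part of `K` in a closed polydisc can be replaced by one peaking
on all of `K`. -/
theorem exists_peak_of_peak_polydisc {K : Set (EuclideanSpace ℂ (Fin n))} (hK : IsCompact K)
    (hpc : IsPolyConvex K) {p : EuclideanSpace ℂ (Fin n)} (hp : p ∈ K) {r₁ r₂ : ℝ} (h₁ : 0 < r₁)
    (h₁₂ : r₁ ≤ r₂) {F : MvPolynomial (Fin n) ℂ} (hFp : evalPoly F p = 1)
    (hF : ∀ z ∈ K, (∀ i, ‖z i - p i‖ ≤ r₂) → z ≠ p → ‖evalPoly F z‖ < 1) :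
    ∃ h : MvPolynomial (Fin n) ℂ, evalPoly h p = 0 ∧
      ∀ z ∈ K, ‖evalPoly h z‖ ≤ 1 / 2 → ∀ i, ‖z i - p i‖ < r₁ := by
  classical
  set U : Set (EuclideanSpace ℂ (Fin n)) := {z | ∀ i, ‖z i - p i‖ < r₁} with hUdef
  have hU : IsOpen U := by
    rw [hUdef, Set.ofPred_forall]
    exact isOpen_iInter_of_finite fun i => isOpen_lt (by fun_prop) continuous_const
  have hpU : p ∈ U := fun i => by simpa using h₁
  let q : Fin n → MvPolynomial (Fin n) ℂ := fun i => .X i - .C (p i)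
  have hq : ∀ i z, evalPoly (q i) z = z i - p i := fun i z => by
    rw [evalPoly_sub, evalPoly_X, evalPoly_C]
  let L : Finset (Fin n) → Set (EuclideanSpace ℂ (Fin n)) := fun s =>
    K ∩ {z | ∀ i ∈ s, ‖evalPoly (q i) z‖ ≤ r₂}
  have hLins : ∀ j s, L (insert j s) = L s ∩ {z | ‖evalPoly (q j) z‖ ≤ r₂} := fun j s => by
    ext z
    simp only [L, Set.mem_inter_iff, Set.mem_ofPred_eq, Finset.forall_mem_insert]
    tauto
  have hL : ∀ s, IsCompact (L s) ∧ IsPolyConvex (L s) := fun s => by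
    induction s using Finset.induction_on with
    | empty => simpa [L] using ⟨hK, hpc⟩
    | insert j s hj ih =>
      rw [hLins]
      exact ⟨ih.1.inter_right (isClosed_le (continuous_evalPoly _).norm continuous_const),
        ih.2.inter_le ih.1 _ _⟩
  have hpL : ∀ s, p ∈ L s := fun s => ⟨hp, fun i _ => by simpa [hq] using h₁.le.trans h₁₂⟩
  have key : ∀ s, (∃ G : MvPolynomial (Fin n) ℂ, evalPoly G p = 1 ∧
      ∀ z ∈ L s, z ∉ U → ‖evalPoly G z‖ < 1) → ∃ G : MvPolynomial (Fin n) ℂ, evalPoly G p = 1 ∧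
      ∀ z ∈ L ∅, z ∉ U → ‖evalPoly G z‖ < 1 := fun s => by
    induction s using Finset.induction_on with
    | empty => exact id
    | insert j s hj ih =>
      rintro ⟨G, hG1, hG⟩
      refine ih (exists_peak_of_peak_inter (hL s).1 (hL s).2 hU (hpL s) (h := q j) (by simp [hq])
        h₁ h₁₂ (fun z hz => by rw [hq]; exact hz j) hG1 fun z hz hz2 hzU => hG z ?_ hzU)
      rw [hLins]
      exact ⟨hz, hz2⟩
  obtain ⟨G, hG1, hG⟩ := key Finset.univ ⟨F, hFp, fun z hz hzU =>
    hF z hz.1 (fun i => by simpa [hq] using hz.2 i (Finset.mem_univ i)) fun h => hzU (h ▸ hpU)⟩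
  obtain ⟨m, hm⟩ := (eventually_forall_norm_pow_le (F := G) (hK.inter_right hU.isClosed_compl)
    (fun z hz => hG z ⟨hz.1, by simp⟩ hz.2) (show (0 : ℝ) < 1 / 4 by norm_num)).exists
  refine ⟨1 - G ^ m, ?_, fun z hz hzh => ?_⟩
  · rw [evalPoly_sub, evalPoly_pow, hG1]; simp [evalPoly]
  · by_contra hzU
    have h1 := hm z ⟨hz, hzU⟩
    rw [evalPoly_sub, evalPoly_pow, show evalPoly 1 z = 1 by simp [evalPoly]] at hzh
    rw [← norm_pow] at h1
    have h2 := norm_add_le (1 - evalPoly G z ^ m) (evalPoly G z ^ m)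
    rw [sub_add_cancel, norm_one] at h2
    linarith

end PeakPolynomial

section LandauKernel

open Filter Topology MeasureTheory Asymptotics

/-- `(1 + z)^N → e^w` when `N → ∞` and `N z → w`, along an arbitrary filter. -/
lemma tendsto_one_add_pow_exp {α : Type*} {l : Filter α} {N : α → ℕ} {z : α → ℂ} {w : ℂ}
    (hN : Tendsto N l atTop) (hz : Tendsto (fun a => (N a : ℂ) * z a) l (𝓝 w)) :
    Tendsto (fun a => (1 + z a) ^ N a) l (𝓝 (Complex.exp w)) := by
  have hN0 : ∀ᶠ a in l, (N a : ℂ) ≠ 0 :=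
    (hN.eventually_gt_atTop 0).mono fun a ha => by exact_mod_cast ha.ne'
  have hinv : Tendsto (fun a => (N a : ℂ)⁻¹) l (𝓝 0) :=
    (tendsto_inv_atTop_nhds_zero_nat (𝕜 := ℂ)).comp hN
  have hz0 : Tendsto z l (𝓝 0) := by
    have h := hinv.mul hz
    rw [zero_mul] at h
    refine h.congr' (hN0.mono fun a ha => ?_)
    rw [inv_mul_cancel_left₀ ha]
  have hlog : (fun ζ : ℂ => Complex.log (1 + ζ) - ζ) =o[𝓝 0] fun ζ => ζ := by
    have h := (Complex.hasDerivAt_log (show (1 : ℂ) ∈ Complex.slitPlane by simp)).isLittleO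
    have h' := h.comp_tendsto (show Tendsto (fun ζ : ℂ => 1 + ζ) (𝓝 0) (𝓝 1) from
      (continuous_const.add continuous_id).tendsto' _ _ (by simp))
    simpa [Function.comp_def] using h'
  have h1 : Tendsto (fun a => (N a : ℂ) * (Complex.log (1 + z a) - z a)) l (𝓝 0) := by
    have h2 : (fun a => (N a : ℂ) * (Complex.log (1 + z a) - z a)) =o[l]
        fun a => (N a : ℂ) * z a := (isBigO_refl _ _).mul_isLittleO (hlog.comp_tendsto hz0)
    exact (isLittleO_one_iff ℂ).1 (h2.trans_isBigO (hz.isBigO_one ℂ))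
  have h3 : Tendsto (fun a => (N a : ℂ) * Complex.log (1 + z a)) l (𝓝 w) := by
    have := h1.add hz
    rw [zero_add] at this
    exact this.congr fun a => by ring
  refine ((Complex.continuous_exp.tendsto w).comp h3).congr' ?_
  have hne : ∀ᶠ a in l, 1 + z a ≠ 0 := by
    have : Tendsto (fun a => 1 + z a) l (𝓝 1) := by simpa using hz0.const_add 1
    exact this.eventually_ne one_ne_zero
  filter_upwards [hne] with a ha
  rw [Function.comp_apply, Complex.exp_nat_mul, Complex.exp_log ha]

/-- Continuous convergence on a compact set is uniform. -/
lemma tendstoUniformlyOn_of_forall_tendsto {α β : Type*} [TopologicalSpace α] [PseudoMetricSpace β]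
    {F : ℕ → α → β} {g : α → β} {s : Set α} (hs : IsCompact s)
    (h : ∀ x ∈ s, Tendsto (fun q : ℕ × α => F q.1 q.2) (atTop ×ˢ 𝓝[s] x) (𝓝 (g x))) :
    TendstoUniformlyOn F g atTop s := by
  rw [← tendstoLocallyUniformlyOn_iff_tendstoUniformlyOn_of_compact hs,
    Metric.tendstoLocallyUniformlyOn_iff]
  intro ε hε x hx
  obtain ⟨pN, hpN, pW, hpW, hpq⟩ := eventually_prod_iff.1
    ((h x hx).eventually (Metric.ball_mem_nhds (g x) (show 0 < ε / 3 by positivity)))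
  refine ⟨{y | y ∈ s ∧ pW y}, hpW.and self_mem_nhdsWithin |>.mono fun y hy => ⟨hy.2, hy.1⟩, ?_⟩
  filter_upwards [hpN] with N hN y hy
  have hg : dist (g y) (g x) ≤ ε / 3 := by
    have hy' : Tendsto (fun N => F N y) atTop (𝓝 (g y)) :=
      (h y hy.1).comp (tendsto_id.prodMk
        ((tendsto_pure.2 (Eventually.of_forall fun _ => rfl)).mono_right
          (pure_le_nhdsWithin hy.1)))
    refine le_of_tendsto (hy'.dist tendsto_const_nhds) ?_
    filter_upwards [hpN] with N hN
    exact (Metric.mem_ball.1 (hpq hN hy.2)).le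
  have h2 := Metric.mem_ball.1 (hpq hN hy.2)
  calc dist (g y) (F N y) ≤ dist (g y) (g x) + dist (F N y) (g x) := dist_triangle_right _ _ _
    _ < ε := by linarith

variable {d : ℕ}

/-- The holomorphic square `∑ vᵢ²`. -/
def holSq (v : EuclideanSpace ℂ (Fin d)) : ℂ := ∑ i, v i ^ 2

lemma continuous_holSq : Continuous (holSq (d := d)) := by unfold holSq; fun_prop

lemma holSq_smul (t : ℝ) (v : EuclideanSpace ℂ (Fin d)) :
    holSq (t • v) = (t : ℂ) ^ 2 * holSq v := by
  simp [holSq, Finset.mul_sum, mul_pow]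

lemma integrable_exp_neg_half_sq :
    Integrable fun u : EuclideanSpace ℝ (Fin d) => Real.exp (-‖u‖ ^ 2 / 2) := by
  have := (GaussianFourier.integrable_cexp_neg_mul_sq_norm_add (V := EuclideanSpace ℝ (Fin d))
    (b := 1 / 2) (by norm_num) 0 0).norm
  refine this.congr (Eventually.of_forall fun u => ?_)
  simp only [Complex.norm_exp]
  congr 1
  simp
  norm_cast
  ring

/-- Asymptotics of the Landau kernels `(1 - ∑ (ψᵢ(x) - ψᵢ(y))²)^N`. -/
theorem tendsto_landau {ψ : EuclideanSpace ℝ (Fin d) → EuclideanSpace ℂ (Fin d)}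
    {s : Set (EuclideanSpace ℝ (Fin d))} (hs : IsCompact s) (hψ : ContinuousOn ψ s)
    (hb : ∀ x ∈ s, ∀ y ∈ s, ‖1 - holSq (ψ x - ψ y)‖ ≤ Real.exp (-‖x - y‖ ^ 2 / 2))
    {f : EuclideanSpace ℝ (Fin d) → ℂ} (hf : Continuous f) (hfs : ∀ y ∉ s, f y = 0)
    {x : EuclideanSpace ℝ (Fin d)} {L : EuclideanSpace ℝ (Fin d) →L[ℝ] EuclideanSpace ℂ (Fin d)}
    (hL : HasStrictFDerivAt ψ L x) :
    Tendsto (fun q : ℕ × EuclideanSpace ℝ (Fin d) =>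
      ((√q.1 ^ d : ℝ) : ℂ) * ∫ y, f y * (1 - holSq (ψ q.2 - ψ y)) ^ q.1) (atTop ×ˢ 𝓝[s] x)
      (𝓝 (∫ u, f x * Complex.exp (-holSq (L u)))) := by
  obtain ⟨C, hC⟩ : ∃ C, ∀ y, ‖f y‖ ≤ C := by
    obtain ⟨C, hC⟩ := hs.exists_bound_of_continuousOn hf.continuousOn
    refine ⟨max C 0, fun y => ?_⟩
    by_cases hy : y ∈ s
    · exact (hC y hy).trans (le_max_left _ _)
    · simp [hfs y hy]
  have hC0 : 0 ≤ C := (norm_nonneg _).trans (hC 0)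
  set G : ℕ × EuclideanSpace ℝ (Fin d) → EuclideanSpace ℝ (Fin d) → ℂ := fun q y =>
    f y * (1 - holSq (ψ q.2 - ψ y)) ^ q.1 with hG
  have hGs : ∀ q, ∀ y ∉ s, G q y = 0 := fun q y hy => by simp [hG, hfs y hy]
  have hmeas : ∀ q, Measurable (G q) := fun q => by
    classical
    have h1 : ContinuousOn (G q) s := by
      refine hf.continuousOn.mul (ContinuousOn.pow ?_ _)
      exact continuousOn_const.sub (continuous_holSq.comp_continuousOn (continuousOn_const.sub hψ))
    have h2 : s.piecewise (G q) 0 = G q := by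
      ext y
      by_cases hy : y ∈ s
      · simp [hy]
      · simp [hy, hGs q y hy]
    rw [← h2]
    exact h1.measurable_piecewise continuousOn_const hs.measurableSet
  have hl1 : Tendsto (fun q : ℕ × EuclideanSpace ℝ (Fin d) => q.1) (atTop ×ˢ 𝓝[s] x) atTop :=
    tendsto_fst
  have hl2 : Tendsto (fun q : ℕ × EuclideanSpace ℝ (Fin d) => q.2) (atTop ×ˢ 𝓝[s] x) (𝓝 x) :=
    tendsto_snd.mono_right nhdsWithin_le_nhds
  have ht : Tendsto (fun q : ℕ × EuclideanSpace ℝ (Fin d) => (√q.1)⁻¹) (atTop ×ˢ 𝓝[s] x)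
      (𝓝 0) :=
    tendsto_inv_atTop_zero.comp (Real.tendsto_sqrt_atTop.comp
      (tendsto_natCast_atTop_atTop.comp hl1))
  have hpos : ∀ᶠ q : ℕ × EuclideanSpace ℝ (Fin d) in atTop ×ˢ 𝓝[s] x, 0 < √(q.1 : ℝ) :=
    (hl1.eventually_gt_atTop 0).mono fun q hq => Real.sqrt_pos.2 (by exact_mod_cast hq)
  have hmem : ∀ᶠ q : ℕ × EuclideanSpace ℝ (Fin d) in atTop ×ˢ 𝓝[s] x, q.2 ∈ s :=
    tendsto_snd.eventually self_mem_nhdsWithin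
  have hcv : ∀ q : ℕ × EuclideanSpace ℝ (Fin d),
      ∫ u, G q (q.2 + (√q.1)⁻¹ • u) = ((√q.1 ^ d : ℝ) : ℂ) * ∫ y, G q y := fun q => by
    rw [Measure.integral_comp_inv_smul volume (fun y => G q (q.2 + y)) √q.1,
      integral_add_left_eq_self (G q), finrank_euclideanSpace_fin, abs_of_nonneg (by positivity),
      Complex.real_smul]
  refine Tendsto.congr hcv ?_
  refine tendsto_integral_filter_of_dominated_convergence
    (fun u => C * Real.exp (-‖u‖ ^ 2 / 2)) (Eventually.of_forall fun q => ?_) ?_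
    (integrable_exp_neg_half_sq.const_mul C) (Eventually.of_forall fun u => ?_)
  · exact ((hmeas q).comp (by fun_prop)).aestronglyMeasurable
  · filter_upwards [hpos, hmem] with q hq hqs
    refine Eventually.of_forall fun u => ?_
    by_cases hy : q.2 + (√q.1)⁻¹ • u ∈ s
    · rw [hG]
      simp only [norm_mul, norm_pow]
      gcongr
      · exact hC _
      · calc _ ≤ Real.exp (-‖q.2 - (q.2 + (√q.1)⁻¹ • u)‖ ^ 2 / 2) ^ q.1 :=
              pow_le_pow_left₀ (norm_nonneg _) (hb _ hqs _ hy) _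
          _ = _ := by
            rw [← Real.exp_nat_mul, sub_add_cancel_left, norm_neg, norm_smul, norm_inv,
              Real.norm_of_nonneg hq.le, mul_pow, inv_pow, Real.sq_sqrt (Nat.cast_nonneg _)]
            have : (q.1 : ℝ) ≠ 0 := (Real.sqrt_pos.1 hq).ne'
            congr 1
            field_simp
    · rw [hGs q _ hy, norm_zero]; positivity
  · have hy : Tendsto (fun q : ℕ × EuclideanSpace ℝ (Fin d) => q.2 + (√q.1)⁻¹ • u)
        (atTop ×ˢ 𝓝[s] x) (𝓝 x) := by simpa using hl2.add (ht.smul_const u)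
    refine ((hf.tendsto x).comp hy).mul ?_
    have hdiff : Tendsto (fun q : ℕ × EuclideanSpace ℝ (Fin d) =>
        √q.1 • (ψ q.2 - ψ (q.2 + (√q.1)⁻¹ • u))) (atTop ×ˢ 𝓝[s] x) (𝓝 (-L u)) := by
      have h1 := hL.isLittleO.comp_tendsto (hl2.prodMk_nhds hy)
      have h2 : (fun q : ℕ × EuclideanSpace ℝ (Fin d) =>
          √q.1 • (ψ q.2 - ψ (q.2 + (√q.1)⁻¹ • u)) + L u) =o[atTop ×ˢ 𝓝[s] x]
          fun _ => (1 : ℝ) := by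
        have h3 := (isBigO_refl (fun q : ℕ × EuclideanSpace ℝ (Fin d) => √(q.1 : ℝ))
          (atTop ×ˢ 𝓝[s] x)).smul_isLittleO h1
        refine (h3.congr' ?_ EventuallyEq.rfl).trans_isBigO ?_
        · filter_upwards [hpos] with q hq
          simp [smul_sub, smul_smul, hq.ne']
        · refine IsBigO.of_bound ‖u‖ ?_
          filter_upwards [hpos] with q hq
          simp [smul_smul, hq.ne']
      have h4 := ((isLittleO_one_iff ℝ).1 h2).sub_const (L u)
      simpa using h4
    have hN : Tendsto (fun q : ℕ × EuclideanSpace ℝ (Fin d) =>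
        (q.1 : ℂ) * -holSq (ψ q.2 - ψ (q.2 + (√q.1)⁻¹ • u))) (atTop ×ˢ 𝓝[s] x)
        (𝓝 (-holSq (L u))) := by
      have h5 := ((continuous_holSq.tendsto _).comp hdiff).neg
      have h6 : holSq (-L u) = holSq (L u) := by simp [holSq]
      rw [h6] at h5
      refine h5.congr fun q => ?_
      rw [Function.comp_apply, holSq_smul, ← Complex.ofReal_pow, Real.sq_sqrt (Nat.cast_nonneg _)]
      simp
    simpa [sub_eq_add_neg] using tendsto_one_add_pow_exp hl1 hN

end LandauKernel

section AdaptedChart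

open Filter Topology

variable {d n : ℕ}

/-- The inclusion `ℝ^d ⊆ ℂ^d`. -/
def realIncl (v : EuclideanSpace ℝ (Fin d)) : EuclideanSpace ℂ (Fin d) :=
  WithLp.toLp 2 fun i => (v i : ℂ)

lemma norm_realIncl (v : EuclideanSpace ℝ (Fin d)) : ‖realIncl v‖ = ‖v‖ := by
  simp [EuclideanSpace.norm_eq, realIncl]

lemma holSq_realIncl (v : EuclideanSpace ℝ (Fin d)) : holSq (realIncl v) = (‖v‖ : ℂ) ^ 2 := by
  rw [← Complex.ofReal_pow, EuclideanSpace.norm_sq_eq]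
  simp [holSq, realIncl]

lemma norm_holSq_le (v : EuclideanSpace ℂ (Fin d)) : ‖holSq v‖ ≤ ‖v‖ ^ 2 := by
  rw [EuclideanSpace.norm_sq_eq]
  refine (norm_sum_le _ _).trans_eq ?_
  simp

lemma holSq_realIncl_add (v : EuclideanSpace ℝ (Fin d)) (e : EuclideanSpace ℂ (Fin d)) :
    holSq (realIncl v + e) = (‖v‖ : ℂ) ^ 2 + 2 * inner ℂ (realIncl v) e + holSq e := by
  rw [← holSq_realIncl, PiLp.inner_apply]
  simp only [holSq, realIncl, PiLp.add_apply, Finset.mul_sum, ← Finset.sum_add_distrib]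
  refine Finset.sum_congr rfl fun i _ => ?_
  simp
  ring

/-- Near the real subspace, `1 - ∑ vᵢ²` decays like a Gaussian. -/
lemma norm_one_sub_holSq_le {v : EuclideanSpace ℂ (Fin d)} {x : EuclideanSpace ℝ (Fin d)}
    (hx : ‖x‖ ≤ 1) (hv : ‖v - realIncl x‖ ≤ 1 / 8 * ‖x‖) :
    ‖1 - holSq v‖ ≤ Real.exp (-‖x‖ ^ 2 / 2) := by
  set e := v - realIncl x with he
  have hve : v = realIncl x + e := by rw [he]; abel
  have h1 : ‖inner ℂ (realIncl x) e‖ ≤ ‖x‖ * (1 / 8 * ‖x‖) := by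
    refine (norm_inner_le_norm _ _).trans ?_
    rw [norm_realIncl]
    gcongr
  have h2 : ‖holSq e‖ ≤ (1 / 8 * ‖x‖) ^ 2 := (norm_holSq_le e).trans (by gcongr)
  have h3 : ‖(1 : ℂ) - (‖x‖ : ℂ) ^ 2‖ = 1 - ‖x‖ ^ 2 := by
    rw [← Complex.ofReal_pow, ← Complex.ofReal_one, ← Complex.ofReal_sub, Complex.norm_real,
      Real.norm_of_nonneg (by nlinarith [norm_nonneg x])]
  calc ‖1 - holSq v‖ = ‖((1 : ℂ) - (‖x‖ : ℂ) ^ 2) - 2 * inner ℂ (realIncl x) e - holSq e‖ := by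
        rw [hve, holSq_realIncl_add]; ring_nf
    _ ≤ (1 - ‖x‖ ^ 2) + 2 * (‖x‖ * (1 / 8 * ‖x‖)) + (1 / 8 * ‖x‖) ^ 2 := by
        refine (norm_sub_le _ _).trans (add_le_add ((norm_sub_le _ _).trans ?_) h2)
        rw [h3, norm_mul, Complex.norm_ofNat]
        gcongr
    _ ≤ -‖x‖ ^ 2 / 2 + 1 := by nlinarith [sq_nonneg ‖x‖]
    _ ≤ _ := Real.add_one_le_exp _

lemma convex_halfSpace (hd : 0 < d) : Convex ℝ (halfSpace d hd) := by
  intro x hx y hy a b ha hb _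
  simp only [halfSpace, Set.mem_ofPred_eq, PiLp.add_apply, PiLp.smul_apply, smul_eq_mul] at *
  positivity

lemma isClosed_halfSpace (hd : 0 < d) : IsClosed (halfSpace d hd) :=
  isClosed_le continuous_const (by fun_prop)

lemma interior_halfSpace_nonempty (hd : 0 < d) : (interior (halfSpace d hd)).Nonempty := by
  have ho : IsOpen {x : EuclideanSpace ℝ (Fin d) | 0 < x ⟨0, hd⟩} :=
    isOpen_lt continuous_const (by fun_prop)
  refine ⟨WithLp.toLp 2 fun _ => 1, interior_maximal (fun x hx => ?_) ho ?_⟩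
  · exact (show 0 < x ⟨0, hd⟩ from hx).le
  · simp

/-- The derivative of a parametrization takes values in the tangent space. -/
lemma fderiv_mem_tangentSpaceAt {hd : 0 < d} {X U : Set (EuclideanSpace ℂ (Fin n))}
    {V : Set (EuclideanSpace ℝ (Fin d))}
    {f : EuclideanSpace ℝ (Fin d) → EuclideanSpace ℂ (Fin n)} (hV : IsOpen V)
    (him : f '' (V ∩ halfSpace d hd) = X ∩ U) {x : EuclideanSpace ℝ (Fin d)}
    (hx : x ∈ V ∩ halfSpace d hd)
    {D : EuclideanSpace ℝ (Fin d) →L[ℝ] EuclideanSpace ℂ (Fin n)} (hD : HasFDerivAt f D x)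
    (v : EuclideanSpace ℝ (Fin d)) : D v ∈ tangentSpaceAt X (f x) := by
  have hu : UniqueDiffWithinAt ℝ (V ∩ halfSpace d hd) x := by
    rw [Set.inter_comm]
    exact (uniqueDiffWithinAt_convex (convex_halfSpace hd) (interior_halfSpace_nonempty hd)
      (subset_closure hx.2)).inter (hV.mem_nhds hx.1)
  have hspan : Submodule.span ℝ (tangentConeAt ℝ (V ∩ halfSpace d hd) x) = ⊤ := by
    have h := hu.dense_tangentConeAt
    rw [← SetLike.coe_set_eq, Submodule.top_coe, ← h.closure_eq]
    exact (Submodule.closed_of_finiteDimensional _).closure_eq.symm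
  have hmap := (hD.hasFDerivWithinAt (s := V ∩ halfSpace d hd)).mapsTo_tangent_cone
  have hle : Submodule.span ℝ (tangentConeAt ℝ (V ∩ halfSpace d hd) x) ≤
      (tangentSpaceAt X (f x)).comap (D : EuclideanSpace ℝ (Fin d) →ₗ[ℝ] _) := by
    refine Submodule.span_le.2 fun w hw => Submodule.subset_span ?_
    refine tangentConeAt_mono ?_ (hmap hw)
    rw [him]
    exact Set.inter_subset_left
  rw [hspan] at hle
  exact hle (Submodule.mem_top : v ∈ ⊤)

/-- A real-linear injection with totally real image has a complex-linear left inverse. -/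
lemma exists_complex_leftInverse
    {D : EuclideanSpace ℝ (Fin d) →L[ℝ] EuclideanSpace ℂ (Fin n)} (hD : Function.Injective D)
    (htr : ∀ a b, D a + Complex.I • D b = 0 → D b = 0) :
    ∃ ℓ : EuclideanSpace ℂ (Fin n) →L[ℂ] EuclideanSpace ℂ (Fin d),
      ∀ v, ℓ (D v) = realIncl v := by
  let re : EuclideanSpace ℂ (Fin d) → EuclideanSpace ℝ (Fin d) := fun u =>
    WithLp.toLp 2 fun i => (u i).re
  let im : EuclideanSpace ℂ (Fin d) → EuclideanSpace ℝ (Fin d) := fun u =>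
    WithLp.toLp 2 fun i => (u i).im
  have hI : ∀ (t : ℝ) (z : EuclideanSpace ℂ (Fin n)), t • z = (t : ℂ) • z := fun t z => by
    ext i; simp
  let DC : EuclideanSpace ℂ (Fin d) →ₗ[ℂ] EuclideanSpace ℂ (Fin n) :=
    { toFun := fun u => D (re u) + Complex.I • D (im u)
      map_add' := fun u w => by
        have h1 : re (u + w) = re u + re w := by ext; simp [re]
        have h2 : im (u + w) = im u + im w := by ext; simp [im]
        rw [h1, h2, map_add, map_add, smul_add]; abel
      map_smul' := fun c u => by
        have h1 : re (c • u) = c.re • re u - c.im • im u := by ext; simp [re, im]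
        have h2 : im (c • u) = c.re • im u + c.im • re u := by ext; simp [re, im]
        rw [h1, h2, map_sub, map_add, map_smul, map_smul, map_smul, map_smul]
        simp only [hI, RingHom.id_apply]
        conv_rhs => rw [← Complex.re_add_im c]
        ext i
        simp only [PiLp.add_apply, PiLp.sub_apply, PiLp.smul_apply, smul_eq_mul]
        linear_combination (-(c.im : ℂ) * D (im u) i) * Complex.I_mul_I }
  have hinj : LinearMap.ker DC = ⊥ := by
    refine LinearMap.ker_eq_bot'.2 fun u hu => ?_
    have hu' : D (re u) + Complex.I • D (im u) = 0 := hu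
    have h1 : D (im u) = 0 := htr _ _ hu'
    rw [h1, smul_zero, add_zero] at hu'
    have h2 : re u = 0 := hD (hu'.trans (map_zero D).symm)
    have h3 : im u = 0 := hD (h1.trans (map_zero D).symm)
    ext i
    exact Complex.ext (congrArg (fun w => w i) h2) (congrArg (fun w => w i) h3)
  obtain ⟨ℓ, hℓ⟩ := DC.exists_leftInverse_of_injective hinj
  refine ⟨LinearMap.toContinuousLinearMap ℓ, fun v => ?_⟩
  have h1 : DC (realIncl v) = D v := by
    change D (re (realIncl v)) + Complex.I • D (im (realIncl v)) = D v
    have h2 : re (realIncl v) = v := by ext; simp [re, realIncl]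
    have h3 : im (realIncl v) = 0 := by ext; simp [im, realIncl]
    rw [h2, h3]; simp
  rw [← h1]
  exact DFunLike.congr_fun hℓ (realIncl v)

/-- Near a totally real point, a submanifold has a parametrization `φ` and a complex-linear map
`ℓ` such that `ℓ ∘ φ` is close to the inclusion `ℝ^d ⊆ ℂ^d`. -/
theorem exists_adapted_chart {hd : 0 < d} {X : Set (EuclideanSpace ℂ (Fin n))}
    (hX : IsSubmanifold d hd X) {p : EuclideanSpace ℂ (Fin n)} (hp : p ∈ X)
    (htr : TotallyRealAt X p) :
    ∃ (φ : EuclideanSpace ℝ (Fin d) → EuclideanSpace ℂ (Fin n))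
      (ℓ : EuclideanSpace ℂ (Fin n) →L[ℂ] EuclideanSpace ℂ (Fin d))
      (L : EuclideanSpace ℝ (Fin d) → EuclideanSpace ℝ (Fin d) →L[ℝ] EuclideanSpace ℂ (Fin d))
      (x₀ : EuclideanSpace ℝ (Fin d)) (r : ℝ) (U : Set (EuclideanSpace ℂ (Fin n))),
      0 < r ∧ x₀ ∈ halfSpace d hd ∧ φ x₀ = p ∧ IsOpen U ∧
      φ '' (Metric.ball x₀ r ∩ halfSpace d hd) = X ∩ U ∧
      ContinuousOn φ (Metric.closedBall x₀ r) ∧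
      Set.MapsTo φ (Metric.closedBall x₀ r ∩ halfSpace d hd) X ∧
      (∀ x ∈ Metric.closedBall x₀ r, HasStrictFDerivAt (fun y => ℓ (φ y)) (L x) x) ∧
      (∀ u, L x₀ u = realIncl u) ∧
      ∀ x ∈ Metric.closedBall x₀ r, ∀ y ∈ Metric.closedBall x₀ r,
        ‖1 - holSq (ℓ (φ x) - ℓ (φ y))‖ ≤ Real.exp (-‖x - y‖ ^ 2 / 2) := by
  obtain ⟨V, U, φ, hV, -, hpU, hφ, -, hinj, him, hloc⟩ := hX p hp
  obtain ⟨x₀, hx₀, rfl⟩ : p ∈ φ '' (V ∩ halfSpace d hd) := him ▸ ⟨hp, hpU⟩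
  have hstrict : ∀ x ∈ V, HasStrictFDerivAt φ (fderiv ℝ φ x) x := fun x hx =>
    (hφ.contDiffAt (hV.mem_nhds hx)).hasStrictFDerivAt (by simp)
  have hT := fderiv_mem_tangentSpaceAt hV him hx₀ (hstrict x₀ hx₀.1).hasFDerivAt
  obtain ⟨ℓ, hℓ⟩ := exists_complex_leftInverse (hinj x₀ hx₀.1) fun a b hab => by
    refine htr _ (hT b) ?_
    rw [← neg_eq_of_add_eq_zero_right hab]
    exact Submodule.neg_mem _ (hT a)
  let L := fun x => (ℓ.restrictScalars ℝ).comp (fderiv ℝ φ x)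
  have hLs : ∀ x ∈ V, HasStrictFDerivAt (fun y => ℓ (φ y)) (L x) x := fun x hx =>
    (ℓ.restrictScalars ℝ).hasStrictFDerivAt.comp x (hstrict x hx)
  have hL0 : ∀ u, L x₀ u = realIncl u := hℓ
  obtain ⟨t, ht, happ⟩ := (hLs x₀ hx₀.1).approximates_deriv_on_nhds (c := 1 / 8)
    (Or.inr (by norm_num))
  obtain ⟨r, hr, hrt⟩ := Metric.nhds_basis_closedBall.mem_iff.1
    (inter_mem ht (hV.mem_nhds hx₀.1))
  have hr' : 0 < min r (1 / 2) := lt_min hr (by norm_num)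
  have hsub : Metric.closedBall x₀ (min r (1 / 2)) ⊆ t ∩ V :=
    (Metric.closedBall_subset_closedBall (min_le_left _ _)).trans hrt
  obtain ⟨U', hU', hU'im⟩ := hloc (Metric.ball x₀ (min r (1 / 2))) Metric.isOpen_ball
    (Metric.ball_subset_closedBall.trans (hsub.trans Set.inter_subset_right))
  refine ⟨φ, ℓ, L, x₀, min r (1 / 2), U', hr', hx₀.2, rfl, hU', hU'im,
    hφ.continuousOn.mono (hsub.trans Set.inter_subset_right), fun y hy => ?_,
    fun x hx => hLs x (hsub hx).2, hL0, fun x hx y hy => ?_⟩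
  · exact (him.le ⟨y, ⟨(hsub hy.1).2, hy.2⟩, rfl⟩).1
  · refine norm_one_sub_holSq_le ?_ ?_
    · have h1 := dist_triangle_right x y x₀
      rw [dist_eq_norm] at h1
      have h2 := Metric.mem_closedBall.1 hx
      have h3 := Metric.mem_closedBall.1 hy
      linarith [min_le_right r (1 / 2)]
    · rw [← hL0]
      simpa using happ x (hsub hx).1 y (hsub hy).1

end AdaptedChart

section Localization

open Filter Topology MeasureTheory

variable {d n : ℕ}

/-- The `i`-th component of a linear map as a polynomial. -/
def linPoly (ℓ : EuclideanSpace ℂ (Fin n) →L[ℂ] EuclideanSpace ℂ (Fin d)) (i : Fin d) :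
    MvPolynomial (Fin n) ℂ :=
  ∑ j, .C (ℓ (EuclideanSpace.single j 1) i) * .X j

lemma evalPoly_linPoly (ℓ : EuclideanSpace ℂ (Fin n) →L[ℂ] EuclideanSpace ℂ (Fin d)) (i : Fin d)
    (z : EuclideanSpace ℂ (Fin n)) : evalPoly (linPoly ℓ i) z = ℓ z i := by
  have hz : z = ∑ j, z j • EuclideanSpace.single j (1 : ℂ) := by
    ext k
    simp [Finset.sum_apply, Pi.single_apply]
  conv_rhs => rw [hz]
  simp [evalPoly, linPoly, map_sum, mul_comm]

/-- The polynomial `1 - ∑ (ℓᵢ(z) - cᵢ)²`. -/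
def landauPoly (ℓ : EuclideanSpace ℂ (Fin n) →L[ℂ] EuclideanSpace ℂ (Fin d))
    (c : EuclideanSpace ℂ (Fin d)) : MvPolynomial (Fin n) ℂ :=
  1 - ∑ i, (linPoly ℓ i - .C (c i)) ^ 2

lemma evalPoly_landauPoly (ℓ : EuclideanSpace ℂ (Fin n) →L[ℂ] EuclideanSpace ℂ (Fin d))
    (c : EuclideanSpace ℂ (Fin d)) (z : EuclideanSpace ℂ (Fin n)) :
    evalPoly (landauPoly ℓ c) z = 1 - holSq (ℓ z - c) := by
  simp only [holSq, PiLp.sub_apply, ← evalPoly_linPoly]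
  simp [evalPoly, landauPoly]

lemma continuous_toPolyClosure_landauPoly {X : Set (EuclideanSpace ℂ (Fin n))} [CompactSpace X]
    (ℓ : EuclideanSpace ℂ (Fin n) →L[ℂ] EuclideanSpace ℂ (Fin d)) :
    Continuous fun c => toPolyClosure X (landauPoly ℓ c) := by
  have hC : ∀ a : ℂ, toPolyClosure X (.C a) = algebraMap ℂ (polyClosure X) a := fun a =>
    (toPolyClosure X).commutes a
  simp only [landauPoly, map_sub, map_one, map_sum, map_pow, hC]
  refine continuous_const.sub (continuous_finsetSum _ fun i _ => Continuous.pow ?_ 2)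
  exact continuous_const.sub ((continuous_algebraMap ℂ (polyClosure X)).comp (by fun_prop))

lemma exists_polydisc_subset {U : Set (EuclideanSpace ℂ (Fin n))} (hU : IsOpen U)
    {p : EuclideanSpace ℂ (Fin n)} (hp : p ∈ U) :
    ∃ r > 0, ∀ z : EuclideanSpace ℂ (Fin n), (∀ i, ‖z i - p i‖ ≤ r) → z ∈ U := by
  have hU' : IsOpen (WithLp.toLp 2 ⁻¹' U : Set (Fin n → ℂ)) :=
    hU.preimage (PiLp.continuous_toLp 2 _)
  obtain ⟨r, hr, hrU⟩ := Metric.nhds_basis_closedBall.mem_iff.1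
    (hU'.mem_nhds (show p.ofLp ∈ (WithLp.toLp 2 ⁻¹' U : Set (Fin n → ℂ)) from hp))
  refine ⟨r, hr, fun z hz => hrU (show z.ofLp ∈ _ from ?_)⟩
  rw [Metric.mem_closedBall, dist_pi_le_iff hr.le]
  exact fun i => (dist_eq_norm _ _).trans_le (hz i)

lemma tendsto_sqrt_pow_mul_half_pow (m d : ℕ) (C : ℝ) :
    Tendsto (fun M : ℕ => √((m * M : ℕ) : ℝ) ^ d * (C * (1 / 2) ^ M)) atTop (𝓝 0) := by
  have h1 : Tendsto (fun M : ℕ => (√m ^ d * C) * (√(M : ℝ) ^ d * (1 / 2) ^ M)) atTop (𝓝 0) := by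
    rw [← mul_zero (√m ^ d * C)]
    refine Tendsto.const_mul _ (squeeze_zero' (Eventually.of_forall fun M => by positivity) ?_
      (tendsto_pow_const_mul_const_pow_of_abs_lt_one d (r := 1 / 2)
        (by rw [abs_of_pos] <;> norm_num)))
    filter_upwards [eventually_ge_atTop 1] with M hM
    have : (1 : ℝ) ≤ M := by exact_mod_cast hM
    gcongr
    exact Real.sqrt_le_iff.2 ⟨by positivity, by nlinarith⟩
  refine h1.congr fun M => ?_
  rw [Nat.cast_mul, Real.sqrt_mul (Nat.cast_nonneg _), mul_pow]
  ring

/-- Landau averages which are small in a cutoff algebra. -/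
lemma tendsto_norm_landau_average {A B : Type*} [NormedCommRing A] [NormedAlgebra ℂ A]
    [CompleteSpace A] [NormedCommRing B] [NormedAlgebra ℂ B] [CompleteSpace B] {ι : A →ₐ[ℂ] B}
    (hι : ∀ a, ‖ι a‖ ≤ ‖a‖) {s : Set (EuclideanSpace ℝ (Fin d))} (hs : IsCompact s)
    {κ : EuclideanSpace ℝ (Fin d) → A} (hκ : ContinuousOn κ s) {m : ℕ}
    (hm : ∀ y ∈ s, ‖ι (κ y) ^ m‖ ≤ 1 / 2) {f : EuclideanSpace ℝ (Fin d) → ℂ} (hf : Continuous f) :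
    Tendsto (fun M : ℕ => ‖ι (((√((m * M : ℕ) : ℝ) ^ d : ℝ) : ℂ) •
      ∫ y in s, f y • κ y ^ (m * M))‖) atTop (𝓝 0) := by
  obtain ⟨C, hC⟩ := hs.exists_bound_of_continuousOn hf.continuousOn
  let ιL : A →L[ℂ] B := ι.toLinearMap.mkContinuous 1 fun a => by rw [one_mul]; exact hι a
  have hιL : ∀ a, ι a = ιL a := fun _ => rfl
  refine squeeze_zero' (Eventually.of_forall fun _ => norm_nonneg _) ?_
    (tendsto_sqrt_pow_mul_half_pow m d (C * volume.real s))
  filter_upwards [eventually_gt_atTop 0] with M hM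
  have hint : IntegrableOn (fun y => f y • κ y ^ (m * M)) s :=
    (hf.continuousOn.smul (hκ.pow _)).integrableOn_compact hs
  rw [hιL, map_smul, ← ιL.integral_comp_comm hint, norm_smul, Complex.norm_real,
    Real.norm_of_nonneg (by positivity)]
  gcongr
  calc ‖∫ y in s, ιL (f y • κ y ^ (m * M))‖ ≤ (C * (1 / 2) ^ M) * volume.real s := by
        refine norm_setIntegral_le_of_norm_le_const hs.measure_lt_top fun y hy => ?_
        rw [map_smul, ← hιL, map_pow, pow_mul, norm_smul]
        have h1 : ‖(ι (κ y) ^ m) ^ M‖ ≤ (1 / 2) ^ M :=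
          (norm_pow_le' _ hM).trans (pow_le_pow_left₀ (norm_nonneg _) (hm y hy) _)
        exact mul_le_mul (hC y hy) h1 (norm_nonneg _) ((norm_nonneg _).trans (hC y hy))
    _ = _ := by ring

/-- Near a totally real point `p` there is `g ∈ C(X)` with `g p ≠ 0` whose multiples by continuous
functions all lie in `𝒫(X)`. -/
theorem exists_mul_mem_polyClosure {hd : 0 < d} {X : Set (EuclideanSpace ℂ (Fin n))}
    [CompactSpace X] (hpc : IsPolyConvex X) (hX : IsSubmanifold d hd X) (p : X)
    (htr : TotallyRealAt X p) :
    ∃ g : C(X, ℂ), g p ≠ 0 ∧ ∀ u : C(X, ℂ), u * g ∈ polyClosure X := by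
  classical
  have : Nonempty X := ⟨p⟩
  obtain ⟨φ, ℓ, L, x₀, r, U, hr, hx₀, hφp, hU, him, hφ, hmaps, hL, hL0, hb⟩ :=
    exists_adapted_chart hX p.2 htr
  have hx₀s : x₀ ∈ Metric.closedBall x₀ r := Metric.mem_closedBall_self hr.le
  have hpU : (p : EuclideanSpace ℂ (Fin n)) ∈ U :=
    (him.le ⟨x₀, ⟨Metric.mem_ball_self hr, hx₀⟩, hφp⟩).2
  obtain ⟨R, hR, hRU⟩ := exists_polydisc_subset hU hpU
  have hpeak : ∀ z ∈ X, z ∈ U → z ≠ p → ‖evalPoly (landauPoly ℓ (ℓ p)) z‖ < 1 := by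
    intro z hz hzU hzp
    obtain ⟨x, hx, rfl⟩ := him.ge ⟨hz, hzU⟩
    rw [evalPoly_landauPoly, ← hφp]
    refine (hb x (Metric.ball_subset_closedBall hx.1) x₀ hx₀s).trans_lt (Real.exp_lt_one_iff.2 ?_)
    have hne : x - x₀ ≠ 0 := sub_ne_zero.2 fun h => hzp (h ▸ hφp)
    have := norm_pos_iff.2 hne
    have := sq_pos_of_pos this
    linarith
  obtain ⟨h, hhp, hh⟩ := exists_peak_of_peak_polydisc (isCompact_iff_compactSpace.2 ‹_›) hpc p.2
    hR le_rfl (F := landauPoly ℓ (ℓ p)) (by simp [evalPoly_landauPoly, holSq])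
    fun z hz hzR => hpeak z hz (hRU z hzR)
  have hhU : ∀ x : X, ‖evalPoly h x‖ ≤ 1 / 2 → (x : EuclideanSpace ℂ (Fin n)) ∈ U := fun x hx =>
    hRU x fun i => (hh x x.2 hx i).le
  obtain ⟨B, _, _, _, ι, hι, hnil, hcut⟩ := exists_cutoff_algebra hpc (toPolyClosure X h)
    (r₁ := 1 / 4) (r₂ := 1 / 2) (by norm_num) (by norm_num)
  simp only [toPolyClosure_apply] at hnil hcut
  set κ : EuclideanSpace ℝ (Fin d) → polyClosure X := fun y =>
    toPolyClosure X (landauPoly ℓ (ℓ (φ y))) with hκdef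
  have hκ : ContinuousOn κ (Metric.closedBall x₀ r) :=
    (continuous_toPolyClosure_landauPoly ℓ).comp_continuousOn (ℓ.continuous.comp_continuousOn hφ)
  have hκx : ∀ y (x : X), (κ y : C(X, ℂ)) x = 1 - holSq (ℓ x - ℓ (φ y)) := fun y x => by
    rw [hκdef, toPolyClosure_apply, evalPoly_landauPoly]
  have hnil0 := hnil (κ x₀) fun x h1 h2 => by
    rw [hκdef, toPolyClosure_apply, hφp]
    refine hpeak x x.2 (hhU x h2) fun hxp => ?_
    rw [hxp, hhp, norm_zero] at h1
    norm_num at h1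
  obtain ⟨m, hm, hm0⟩ := ((hnil0.eventually_lt_const (show (0 : ℝ) < 1 / 2 by norm_num)).and
    (eventually_gt_atTop 0)).exists
  have hιc : Continuous ι := AddMonoidHomClass.continuous_of_bound ι 1 fun a => by
    rw [one_mul]; exact hι a
  have hκm : ContinuousAt (fun y => ‖ι (κ y) ^ m‖) x₀ :=
    (((hιc.comp_continuousOn hκ).pow m).norm).continuousAt (Metric.closedBall_mem_nhds x₀ hr)
  obtain ⟨r', hr', hr'm⟩ := Metric.nhds_basis_closedBall.mem_iff.1
    (inter_mem (hκm.eventually (gt_mem_nhds hm)) (Metric.closedBall_mem_nhds x₀ hr))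
  set s' := Metric.closedBall x₀ r' with hs'
  have hs'c : IsCompact s' := isCompact_closedBall x₀ r'
  let η : EuclideanSpace ℝ (Fin d) → ℝ := fun y => max 0 (r' - dist y x₀)
  have hη : Continuous η := by fun_prop
  have hη0 : ∀ y ∉ s', η y = 0 := fun y hy => by
    rw [hs', Metric.mem_closedBall, not_le] at hy
    exact max_eq_left (by linarith)
  have hexY : ∀ x : X, ∃ y, ‖evalPoly h x‖ ≤ 1 / 2 →
      y ∈ Metric.ball x₀ r ∩ halfSpace d hd ∧ φ y = x := fun x => by
    by_cases hx : ‖evalPoly h x‖ ≤ 1 / 2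
    · obtain ⟨y, hy, hyx⟩ := him.ge ⟨x.2, hhU x hx⟩
      exact ⟨y, fun _ => ⟨hy, hyx⟩⟩
    · exact ⟨x₀, fun h => absurd h hx⟩
  choose Y hY using hexY
  let G : X → ℂ := fun x => if ‖evalPoly h x‖ ≤ 1 / 2 then
    η (Y x) * ∫ u, Complex.exp (-holSq (L (Y x) u)) else 0
  have key : ∀ u : C(X, ℂ), ∃ a : ℕ → polyClosure X,
      TendstoUniformly (fun M x => (a M : C(X, ℂ)) x) (fun x => u x * G x) atTop := by
    intro u
    set s := Metric.closedBall x₀ r with hs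
    have hsc : IsCompact s := isCompact_closedBall x₀ r
    obtain ⟨w, hw⟩ : ∃ w : C(EuclideanSpace ℝ (Fin d), ℂ),
        ∀ y (hy : y ∈ s ∩ halfSpace d hd), w y = u ⟨φ y, hmaps hy⟩ := by
      obtain ⟨w, hw⟩ := ContinuousMap.exists_restrict_eq
        (hsc.isClosed.inter (isClosed_halfSpace hd))
        (⟨fun y => u ⟨φ y, hmaps y.2⟩, u.continuous.comp (Continuous.subtype_mk
          ((hφ.mono Set.inter_subset_left).domRestrict) _)⟩ :
          C((s ∩ halfSpace d hd : Set (EuclideanSpace ℝ (Fin d))), ℂ))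
      exact ⟨w, fun y hy => DFunLike.congr_fun hw ⟨y, hy⟩⟩
    let f : EuclideanSpace ℝ (Fin d) → ℂ := fun y => η y * w y
    have hf : Continuous f := (Complex.continuous_ofReal.comp hη).mul w.continuous
    have hfs' : ∀ y ∉ s', f y = 0 := fun y hy => by simp [f, hη0 y hy]
    have hs's : s' ⊆ s := fun y hy => (hr'm hy).2
    have hunif := tendstoUniformlyOn_of_forall_tendsto (F := fun N x =>
        ((√(N : ℝ) ^ d : ℝ) : ℂ) * ∫ y, f y * (1 - holSq (ℓ (φ x) - ℓ (φ y))) ^ N)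
      (g := fun x => ∫ u, f x * Complex.exp (-holSq (L x u))) hsc fun x hx =>
        tendsto_landau (ψ := fun y => ℓ (φ y)) hsc (ℓ.continuous.comp_continuousOn hφ) hb hf
          (fun y hy => hfs' y fun hy' => hy (hs's hy')) (hL x hx)
    set b : ℕ → polyClosure X := fun M => ((√((m * M : ℕ) : ℝ) ^ d : ℝ) : ℂ) •
      ∫ y in s', f y • κ y ^ (m * M) with hbdef
    have hbx : ∀ M (x : X), (b M : C(X, ℂ)) x = ((√((m * M : ℕ) : ℝ) ^ d : ℝ) : ℂ) *
        ∫ y, f y * (1 - holSq (ℓ x - ℓ (φ y))) ^ (m * M) := fun M x => by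
      let ev : polyClosure X →L[ℂ] ℂ :=
        ((ContinuousMap.evalAlgHom ℂ ℂ x).comp (polyClosure X).val).toLinearMap.mkContinuous 1
          fun a => by rw [one_mul]; exact ContinuousMap.norm_coe_le_norm (a : C(X, ℂ)) x
      have hev : ∀ a : polyClosure X, ev a = (a : C(X, ℂ)) x := fun _ => rfl
      have hint : IntegrableOn (fun y => f y • κ y ^ (m * M)) s' :=
        (hf.continuousOn.smul ((hκ.mono hs's).pow _)).integrableOn_compact hs'c
      rw [← hev, hbdef, map_smul, smul_eq_mul, ← ev.integral_comp_comm hint,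
        setIntegral_eq_integral_of_forall_compl_eq_zero
          (fun y hy => by rw [hfs' y hy, zero_smul, map_zero])]
      congr 2
      ext y
      rw [map_smul, hev, smul_eq_mul, ← hκx]
      rfl
    have hb0 : Tendsto (fun M => ‖ι (b M)‖ + 1 / ((M : ℝ) + 1)) atTop (𝓝 0) := by
      have := (tendsto_norm_landau_average hι hs'c (hκ.mono hs's) (m := m)
        (fun y hy => (hr'm hy).1.le) hf).add tendsto_one_div_add_atTop_nhds_zero_nat
      rwa [add_zero] at this
    have hexa : ∀ M, ∃ F : polyClosure X, ∀ x : X,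
        (‖evalPoly h x‖ ≤ 1 / 2 → ‖(F : C(X, ℂ)) x - (b M : C(X, ℂ)) x‖ ≤
          ‖ι (b M)‖ + 1 / ((M : ℝ) + 1)) ∧
        (1 / 4 ≤ ‖evalPoly h x‖ → ‖(F : C(X, ℂ)) x‖ ≤ ‖ι (b M)‖ + 1 / ((M : ℝ) + 1)) := fun M =>
      hcut (b M) _ (lt_add_of_pos_right _ Nat.one_div_pos_of_nat)
    choose a ha using hexa
    refine ⟨a, Metric.tendstoUniformly_iff.2 fun ε hε => ?_⟩
    have hmM : Tendsto (fun M => m * M) atTop atTop := tendsto_id.const_mul_atTop' hm0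
    filter_upwards [hb0.eventually_lt_const (half_pos hε),
      hmM.eventually (Metric.tendstoUniformlyOn_iff.1 hunif (ε / 2) (half_pos hε))]
      with M hM1 hM2 x
    by_cases hx : ‖evalPoly h x‖ ≤ 1 / 2
    · obtain ⟨⟨hYb, hYH⟩, hYx⟩ := hY x hx
      have hYs : Y x ∈ s := Metric.ball_subset_closedBall hYb
      have h1 := hM2 (Y x) hYs
      have h2 := (ha M x).1 hx
      rw [hYx, ← hbx, integral_const_mul] at h1
      have h3 : f (Y x) = u x * η (Y x) := by
        simp only [f, hw (Y x) ⟨hYs, hYH⟩, hYx, mul_comm]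
      have h4 : u x * G x = f (Y x) * ∫ u, Complex.exp (-holSq (L (Y x) u)) := by
        simp only [G, if_pos hx, h3, mul_assoc]
      rw [h4]
      rw [← dist_eq_norm, dist_comm] at h2
      linarith [dist_triangle (f (Y x) * ∫ u, Complex.exp (-holSq (L (Y x) u)))
        ((b M : C(X, ℂ)) x) ((a M : C(X, ℂ)) x)]
    · have h2 := (ha M x).2 (by linarith)
      have h4 : u x * G x = 0 := by simp only [G, if_neg hx, mul_zero]
      rw [h4, dist_zero_left]
      linarith
  have hGc : Continuous G := by
    obtain ⟨a, ha⟩ := key 1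
    simpa using ha.continuous (Frequently.of_forall fun M => (a M : C(X, ℂ)).continuous)
  refine ⟨⟨G, hGc⟩, ?_, fun u => ?_⟩
  · have hp0 : ‖evalPoly h p‖ ≤ 1 / 2 := by rw [hhp]; norm_num
    obtain ⟨⟨hYb, hYH⟩, hYp⟩ := hY p hp0
    have hYx₀ : Y p = x₀ := by
      by_contra hne
      have h1 := hb (Y p) (Metric.ball_subset_closedBall hYb) x₀ hx₀s
      rw [hYp, hφp, sub_self] at h1
      have h2 := norm_pos_iff.2 (sub_ne_zero.2 hne)
      have h3 : Real.exp (-‖Y p - x₀‖ ^ 2 / 2) < 1 := Real.exp_lt_one_iff.2 (by nlinarith)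
      simp [holSq] at h1
      linarith [sq_pos_of_pos h2]
    have hint : ∫ u, Complex.exp (-holSq (L x₀ u)) =
        ((∫ u : EuclideanSpace ℝ (Fin d), Real.exp (-1 * ‖u‖ ^ 2) : ℝ) : ℂ) := by
      rw [← integral_complex_ofReal]
      congr 1
      ext u
      rw [hL0, holSq_realIncl]
      push_cast
      simp
    change G p ≠ 0
    simp only [G, if_pos hp0, hYx₀, hint]
    rw [GaussianFourier.integral_rexp_neg_mul_sq_norm one_pos]
    have hη1 : η x₀ = r' := by simp [η, hr'.le]
    rw [hη1]
    exact_mod_cast (mul_pos hr' (by positivity)).ne'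
  · obtain ⟨a, ha⟩ := key u
    have ht : Tendsto (fun M => (a M : C(X, ℂ))) atTop (𝓝 (u * ⟨G, hGc⟩)) :=
      ContinuousMap.tendsto_iff_tendstoUniformly.2 ha
    exact (Subalgebra.isClosed_topologicalClosure _).mem_of_tendsto ht
      (Eventually.of_forall fun M => (a M).2)

end Localization

section Globalization

variable {n : ℕ}

/-- The ideal of all `g ∈ C(X)` such that `C(X) · g ⊆ 𝒫(X)`. -/
def polyConductor (X : Set (EuclideanSpace ℂ (Fin n))) [CompactSpace X] : Ideal C(X, ℂ) where
  carrier := {g | ∀ u : C(X, ℂ), u * g ∈ polyClosure X}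
  zero_mem' u := by rw [mul_zero]; exact zero_mem _
  add_mem' ha hb u := by rw [mul_add]; exact add_mem (ha u) (hb u)
  smul_mem' c g hg u := by rw [smul_eq_mul, ← mul_assoc]; exact hg (u * c)

lemma mem_polyConductor {X : Set (EuclideanSpace ℂ (Fin n))} [CompactSpace X] {g : C(X, ℂ)} :
    g ∈ polyConductor X ↔ ∀ u : C(X, ℂ), u * g ∈ polyClosure X :=
  Iff.rfl

lemma isClosed_polyClosure (X : Set (EuclideanSpace ℂ (Fin n))) [CompactSpace X] :
    IsClosed (polyClosure X : Set C(X, ℂ)) :=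
  Subalgebra.isClosed_topologicalClosure _

lemma isClosed_polyConductor (X : Set (EuclideanSpace ℂ (Fin n))) [CompactSpace X] :
    IsClosed (polyConductor X : Set C(X, ℂ)) := by
  have : (polyConductor X : Set C(X, ℂ)) = ⋂ u : C(X, ℂ), (u * ·) ⁻¹' (polyClosure X) := by
    ext g
    simp [mem_polyConductor]
  rw [this]
  exact isClosed_iInter fun u => (isClosed_polyClosure X).preimage (continuous_const_mul u)

/-- Functions vanishing off the support of the conductor ideal belong to `𝒫(X)`. -/
lemma mem_polyClosure_of_eq_zero {X : Set (EuclideanSpace ℂ (Fin n))} [CompactSpace X]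
    {S : Set X} (hS : ∀ p ∉ S, ∃ g ∈ polyConductor X, g p ≠ 0) {f : C(X, ℂ)}
    (hf : ∀ p ∈ S, f p = 0) : f ∈ polyClosure X := by
  have h : f ∈ (polyConductor X).closure := by
    rw [← ContinuousMap.idealOfSet_ofIdeal_eq_closure, ContinuousMap.mem_idealOfSet]
    intro p hp
    by_contra hfp
    refine hp ?_
    obtain ⟨g, hg, hgp⟩ := hS p fun hpS => hfp (hf p hpS)
    exact ContinuousMap.mem_setOfIdeal.2 ⟨g, hg, hgp⟩
  have h' : f ∈ polyConductor X := (isClosed_polyConductor X).closure_eq.le h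
  simpa using h' 1

lemma exists_evalPoly_interpolate (S : Finset (EuclideanSpace ℂ (Fin n)))
    (c : EuclideanSpace ℂ (Fin n) → ℂ) :
    ∃ P : MvPolynomial (Fin n) ℂ, ∀ p ∈ S, evalPoly P p = c p := by
  classical
  induction S using Finset.induction_on with
  | empty => exact ⟨0, by simp⟩
  | insert q S hq ih =>
    obtain ⟨P, hP⟩ := ih
    have hsep : ∀ p ∈ S, ∃ R : MvPolynomial (Fin n) ℂ, evalPoly R p = 0 ∧ evalPoly R q ≠ 0 := by
      intro p hp
      obtain ⟨i, hi⟩ : ∃ i, q i ≠ p i := by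
        by_contra! h
        exact hq ((show q = p by ext i; exact h i) ▸ hp)
      exact ⟨.X i - .C (p i), by simp [evalPoly], by simpa [evalPoly] using sub_ne_zero.2 hi⟩
    choose! R hRp hRq using hsep
    let Q : MvPolynomial (Fin n) ℂ := ∏ p ∈ S, R p
    have hQ : ∀ z, evalPoly Q z = ∏ p ∈ S, evalPoly (R p) z := fun z => by
      simp [evalPoly, Q, map_prod]
    have hQq : evalPoly Q q ≠ 0 := by
      rw [hQ]
      exact Finset.prod_ne_zero_iff.2 hRq
    refine ⟨P + .C ((c q - evalPoly P q) / evalPoly Q q) * Q, fun p hp => ?_⟩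
    have heval : ∀ z, evalPoly (P + .C ((c q - evalPoly P q) / evalPoly Q q) * Q) z =
        evalPoly P z + (c q - evalPoly P q) / evalPoly Q q * evalPoly Q z := fun z => by
      simp only [evalPoly, map_add, map_mul, MvPolynomial.eval_C]
    rw [heval]
    rcases Finset.mem_insert.1 hp with rfl | hpS
    · field_simp
      ring
    · rw [hQ p, Finset.prod_eq_zero (f := fun t => evalPoly (R t) p) hpS (hRp p hpS), mul_zero,
        add_zero, hP p hpS]

theorem polyClosure_eq_top {d : ℕ} {hd : 0 < d} {X S : Set (EuclideanSpace ℂ (Fin n))}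
    [CompactSpace X] (hpc : IsPolyConvex X) (hX : IsSubmanifold d hd X) (hS : S.Finite)
    (htr : ∀ p ∈ X \ S, TotallyRealAt X p) : polyClosure X = ⊤ := by
  refine eq_top_iff.2 fun f _ => ?_
  obtain ⟨P, hP⟩ := exists_evalPoly_interpolate hS.toFinset (Function.extend Subtype.val f 0)
  have h : f - (toPolyClosure X P : C(X, ℂ)) ∈ polyClosure X := by
    refine mem_polyClosure_of_eq_zero (S := Subtype.val ⁻¹' S) (fun p hp => ?_) fun p hp => ?_
    · obtain ⟨g, hgp, hg⟩ := exists_mul_mem_polyClosure hpc hX p (htr p ⟨p.2, hp⟩)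
      exact ⟨g, hg, hgp⟩
    · rw [ContinuousMap.sub_apply, toPolyClosure_apply, hP p (hS.mem_toFinset.2 hp),
        Subtype.val_injective.extend_apply, sub_self]
  simpa using add_mem h (toPolyClosure X P).2

/-- If polynomials are dense in `C(X)`, compact subsets of a polynomially convex `X` are
polynomially convex. -/
theorem IsPolyConvex.of_subset {X T : Set (EuclideanSpace ℂ (Fin n))} (hXc : IsCompact X)
    (hpc : IsPolyConvex X)
    (hdense : ∀ g : EuclideanSpace ℂ (Fin n) → ℂ, ContinuousOn g X → ∀ ε > (0 : ℝ),
      ∃ P : MvPolynomial (Fin n) ℂ, ∀ x ∈ X, ‖g x - evalPoly P x‖ < ε)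
    (hTX : T ⊆ X) (hT : IsCompact T) : IsPolyConvex T := by
  refine Set.Subset.antisymm (fun z hz => ?_) (subset_polyHull hT)
  rw [mem_polyHull_iff hT] at hz
  have hzX : z ∈ X := hpc.le ((mem_polyHull_iff hXc).2 fun P c hc =>
    hz P c fun w hw => hc w (hTX hw))
  by_contra hzT
  obtain ⟨g, hg0, hg1, -⟩ := exists_continuous_zero_one_of_isClosed hT.isClosed
    (isClosed_singleton (x := z)) (Set.disjoint_singleton_right.2 hzT)
  obtain ⟨P, hP⟩ := hdense (fun x => g x) (by fun_prop) (1 / 3) (by norm_num)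
  have h1 := hz P (1 / 3) fun w hw => by
    have := hP w (hTX hw)
    rw [hg0 hw] at this
    simpa using this.le
  have h2 := hP z hzX
  rw [hg1 rfl] at h2
  simp only [Pi.one_apply, Complex.ofReal_one] at h2
  have h3 := norm_sub_norm_le (1 : ℂ) (evalPoly P z)
  rw [norm_one] at h3
  linarith

end Globalization

/-- If `X ⊆ ℂ^{3k-1}` (`k > 1`) is a compact polynomially convex set that is a
`2k`-dimensional smooth submanifold, totally real except at a finite set `S` of generic
CR-singularities, then every continuous function on `X` is a uniform limit of holomorphic
polynomials (`𝒫(X) = C(X)`); consequently every compact subset of `X` is polynomially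
convex. -/
theorem polynomial_approximation_on_polyConvex_submanifold
    (k : ℕ) (hk : 1 < k)
    (X S : Set (EuclideanSpace ℂ (Fin (3*k-1))))
    (hcpt : IsCompact X) (hpc : IsPolyConvex X)
    (hsub : IsSubmanifold (2*k) (by omega) X)
    (hS : S.Finite) (hSX : S ⊆ X)
    (htr : ∀ p ∈ X \ S, TotallyRealAt X p)
    (hcr : ∀ p ∈ S, IsGenericCRSingularity k hk X p) :
    (∀ g : EuclideanSpace ℂ (Fin (3*k-1)) → ℂ, ContinuousOn g X →
      ∀ ε > (0:ℝ), ∃ P : MvPolynomial (Fin (3*k-1)) ℂ,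
        ∀ x ∈ X, ‖g x - evalPoly P x‖ < ε) ∧
    (∀ T ⊆ X, IsCompact T → IsPolyConvex T) := by
  have : CompactSpace X := isCompact_iff_compactSpace.1 hcpt
  refine (fun h => ⟨h, fun T hTX hT => hpc.of_subset hcpt h hTX hT⟩) fun g hg ε hε => ?_
  obtain ⟨P, hP⟩ := exists_evalPoly_near (X := X)
    ⟨⟨X.domRestrict g, hg.domRestrict⟩, by
      rw [polyClosure_eq_top hpc hsub hS htr]; exact Algebra.mem_top⟩ hε
  exact ⟨P, fun x hx => hP ⟨x, hx⟩⟩
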